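/- arXiv:1008.2721 — 3 statements merged into one kernel-verified Lean document; each statement's English description precedes it below -/
import Mathlib

section
/- Let M be the set of 1960 degree-7 monomials (((aσbσcσ)dσeσ)fσgσ) with bσ<cσ, dσ<eσ, fσ<gσ; ((aσ(bσcσdσ)eσ)fσgσ) with bσ<cσ<dσ, fσ<gσ; ((aσbσcσ)(dσeσfσ)gσ) with bσ<cσ, dσ<eσ<fσ; (aσ((bσcσdσ)eσfσ)gσ) with bσ<cσ<dσ, eσ<fσ; and (aσ(bσcσdσ)(eσfσgσ)) with bσ<cσ<dσ, eσ<fσ<gσ, bσ<eσ, where σ ranges over permutations of {a,b,c,d,e,f,g}. Then the subspace of ℚ^M of coefficient vectors x such that Σ_{m∈M} x_m·m = 0 under the PATS in every associative dialgebra over ℚ has dimension 49; it is the direct sum of the S₇-submodule generated by the identity R ≡ 0, which has dimension 7, and the S₇-submodule generated by the identity S ≡ 0, which has dimension 42. In particular, every multilinear polynomial identity of degree ≤ 7 satisfied by the PATS is a consequence of P ≡ 0, Q ≡ 0, R ≡ 0 and S ≡ 0. -/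
/-- An associative dialgebra over a commutative ring `k`: a `k`-module `D` with two
bilinear products `l` (left, `⊣`) and `r` (right, `⊢`) satisfying the five dialgebra axioms. -/
structure Dialgebra (k : Type*) (D : Type*) [CommRing k] [AddCommGroup D] [Module k D] where
  l : D →ₗ[k] D →ₗ[k] D
  r : D →ₗ[k] D →ₗ[k] D
  l_assoc : ∀ a b c : D, l (l a b) c = l a (l b c)
  r_assoc : ∀ a b c : D, r (r a b) c = r a (r b c)
  inner_assoc : ∀ a b c : D, l (r a b) c = r a (l b c)
  bar_right : ∀ a b c : D, r (l a b) c = r (r a b) c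
  bar_left : ∀ a b c : D, l a (l b c) = l a (r b c)

/-- The partially alternating ternary sum (PATS):
`[a,b,c] = a⊣b⊣c − a⊣c⊣b − (b⊢a)⊣c + (c⊢a)⊣b + b⊢(c⊢a) − c⊢(b⊢a)`. -/
def Dialgebra.pats {k D : Type*} [CommRing k] [AddCommGroup D] [Module k D]
    (A : Dialgebra k D) (a b c : D) : D :=
  A.l (A.l a b) c - A.l (A.l a c) b - A.l (A.r b a) c + A.l (A.r c a) b
    + A.r b (A.r c a) - A.r c (A.r b a)

/-- The index set of the 1960 straightened multilinear degree-7 ternary monomials.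
The five association types are
`0 : (((x₀x₁x₂)x₃x₄)x₅x₆)` with `τ1<τ2, τ3<τ4, τ5<τ6`;
`1 : ((x₀(x₁x₂x₃)x₄)x₅x₆)` with `τ1<τ2<τ3, τ5<τ6`;
`2 : ((x₀x₁x₂)(x₃x₄x₅)x₆)` with `τ1<τ2, τ3<τ4<τ5`;
`3 : (x₀((x₁x₂x₃)x₄x₅)x₆)` with `τ1<τ2<τ3, τ4<τ5`;
`4 : (x₀(x₁x₂x₃)(x₄x₅x₆))` with `τ1<τ2<τ3, τ4<τ5<τ6, τ1<τ4`. -/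
def Mon7 : Type :=
  {p : Fin 5 × Equiv.Perm (Fin 7) //
    (p.1 = 0 → p.2 1 < p.2 2 ∧ p.2 3 < p.2 4 ∧ p.2 5 < p.2 6) ∧
    (p.1 = 1 → p.2 1 < p.2 2 ∧ p.2 2 < p.2 3 ∧ p.2 5 < p.2 6) ∧
    (p.1 = 2 → p.2 1 < p.2 2 ∧ p.2 3 < p.2 4 ∧ p.2 4 < p.2 5) ∧
    (p.1 = 3 → p.2 1 < p.2 2 ∧ p.2 2 < p.2 3 ∧ p.2 4 < p.2 5) ∧
    (p.1 = 4 → p.2 1 < p.2 2 ∧ p.2 2 < p.2 3 ∧ p.2 4 < p.2 5 ∧ p.2 5 < p.2 6 ∧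
      p.2 1 < p.2 4)}

noncomputable instance : Fintype Mon7 := by
  unfold Mon7
  classical
  infer_instance

/-- Evaluation of a straightened degree-7 monomial under the PATS. -/
def evalMon7 {D : Type} [AddCommGroup D] [Module ℚ D] (A : Dialgebra ℚ D)
    (v : Fin 7 → D) (m : Mon7) : D :=
  if m.1.1 = 0 then
    A.pats (A.pats (A.pats (v (m.1.2 0)) (v (m.1.2 1)) (v (m.1.2 2))) (v (m.1.2 3))
      (v (m.1.2 4))) (v (m.1.2 5)) (v (m.1.2 6))
  else if m.1.1 = 1 then
    A.pats (A.pats (v (m.1.2 0)) (A.pats (v (m.1.2 1)) (v (m.1.2 2)) (v (m.1.2 3)))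
      (v (m.1.2 4))) (v (m.1.2 5)) (v (m.1.2 6))
  else if m.1.1 = 2 then
    A.pats (A.pats (v (m.1.2 0)) (v (m.1.2 1)) (v (m.1.2 2)))
      (A.pats (v (m.1.2 3)) (v (m.1.2 4)) (v (m.1.2 5))) (v (m.1.2 6))
  else if m.1.1 = 3 then
    A.pats (v (m.1.2 0)) (A.pats (A.pats (v (m.1.2 1)) (v (m.1.2 2)) (v (m.1.2 3)))
      (v (m.1.2 4)) (v (m.1.2 5))) (v (m.1.2 6))
  else
    A.pats (v (m.1.2 0)) (A.pats (v (m.1.2 1)) (v (m.1.2 2)) (v (m.1.2 3)))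
      (A.pats (v (m.1.2 4)) (v (m.1.2 5)) (v (m.1.2 6)))

/-- The sign of a permutation, as a rational number. -/
def sgn {n : ℕ} (τ : Equiv.Perm (Fin n)) : ℚ := ((Equiv.Perm.sign τ : ℤ) : ℚ)

/-- The coefficient vector (after straightening by `P` and `Q`) of the image of the
identity `R` under the permutation `π` of the seven variables. -/
def vecR (π : Equiv.Perm (Fin 7)) : Mon7 → ℚ := fun m =>
  sgn π *
    (if m.1.1 = 1 ∧ m.1.2 0 = π 0 then sgn m.1.2
     else if m.1.1 = 2 ∧ m.1.2 0 = π 0 then -sgn m.1.2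
     else 0)

/-- The coefficient vector (after straightening by `P` and `Q`) of the image of the
identity `S` under the permutation `π` of the seven variables. -/
def vecS (π : Equiv.Perm (Fin 7)) : Mon7 → ℚ := fun m =>
  sgn π *
    (if m.1.1 = 0 ∧ m.1.2 0 = π 0 ∧ (m.1.2 3 = π 6 ∨ m.1.2 4 = π 6) then sgn m.1.2
     else if m.1.1 = 1 ∧ m.1.2 0 = π 0 ∧ (m.1.2 5 = π 6 ∨ m.1.2 6 = π 6) then -sgn m.1.2
     else if m.1.1 = 1 ∧ m.1.2 0 = π 0 ∧ (m.1.2 1 = π 6 ∨ m.1.2 2 = π 6 ∨ m.1.2 3 = π 6)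
       then -sgn m.1.2
     else if m.1.1 = 2 ∧ m.1.2 0 = π 0 ∧ m.1.2 6 = π 6 then sgn m.1.2
     else if m.1.1 = 3 ∧ m.1.2 0 = π 0 ∧ (m.1.2 4 = π 6 ∨ m.1.2 5 = π 6) then sgn m.1.2
     else if m.1.1 = 4 ∧ m.1.2 0 = π 0 then -sgn m.1.2
     else 0)

/-- The `S₇`-submodule of `ℚ^{Mon7}` generated by the identity `R`. -/
noncomputable def spanR : Submodule ℚ (Mon7 → ℚ) := Submodule.span ℚ (Set.range vecR)

/-- The `S₇`-submodule of `ℚ^{Mon7}` generated by the identity `S`. -/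
noncomputable def spanS : Submodule ℚ (Mon7 → ℚ) := Submodule.span ℚ (Set.range vecS)

/-- The permutation of `Fin 7` given by mutually inverse tables. -/
def permOf (f g : Fin 7 → Fin 7) (h : ∀ i, g (f i) = i ∧ f (g i) = i := by decide) :
    Equiv.Perm (Fin 7) :=
  ⟨f, g, fun i => (h i).1, fun i => (h i).2⟩

/-- Alternating sum of a function of seven arguments over a list of permutations. -/
def altSum {D : Type*} [AddCommGroup D] [Module ℚ D] (H : List (Equiv.Perm (Fin 7)))
    (F : (Fin 7 → D) → D) (w : Fin 7 → D) : D :=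
  (H.map fun h => sgn h • F (w ∘ h)).sum

/-- Sum of a coefficient function over the inverses of a list of permutations. -/
def symSum (H : List (Equiv.Perm (Fin 7))) (G : (Fin 7 → Fin 7) → ℚ) (w : Fin 7 → Fin 7) : ℚ :=
  (H.map fun h : Equiv.Perm (Fin 7) => G (w ∘ ⇑(h⁻¹))).sum

theorem sgn_mul {n : ℕ} (σ τ : Equiv.Perm (Fin n)) : sgn (σ * τ) = sgn σ * sgn τ := by
  simp [sgn]

theorem sgn_mul_self {n : ℕ} (σ : Equiv.Perm (Fin n)) : sgn σ * sgn σ = 1 := by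
  rcases Int.units_eq_one_or (Equiv.Perm.sign σ) with h | h <;> simp [sgn, h]

theorem sgn_ne_zero {n : ℕ} (σ : Equiv.Perm (Fin n)) : sgn σ ≠ 0 := fun h => by
  simpa [h] using sgn_mul_self σ

theorem sum_smul_altSum {D : Type*} [AddCommGroup D] [Module ℚ D]
    (H : List (Equiv.Perm (Fin 7))) (G : (Fin 7 → Fin 7) → ℚ) (F : (Fin 7 → D) → D)
    (v : Fin 7 → D) :
    ∑ π : Equiv.Perm (Fin 7), (sgn π * G π) • altSum H F (v ∘ π)
      = ∑ π : Equiv.Perm (Fin 7), (sgn π * symSum H G π) • F (v ∘ π) := by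
  induction H with
  | nil => simp [altSum, symSum]
  | cons h H ih =>
    have hsum : ∑ π : Equiv.Perm (Fin 7), (sgn π * G π) • sgn h • F ((v ∘ π) ∘ h)
        = ∑ π : Equiv.Perm (Fin 7), (sgn π * G (π ∘ ⇑(h⁻¹))) • F (v ∘ π) := by
      refine Fintype.sum_equiv (Equiv.mulRight h) _ _ fun π => ?_
      have hG : ⇑(π * h) ∘ ⇑(h⁻¹) = ⇑π := by
        rw [← Equiv.Perm.coe_mul, mul_inv_cancel_right]
      rw [smul_smul, Equiv.coe_mulRight, hG, sgn_mul, Equiv.Perm.coe_mul, Function.comp_assoc]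
      congr 1
      ring
    simp only [altSum, symSum, List.map_cons, List.sum_cons, smul_add, mul_add, add_smul,
      Finset.sum_add_distrib] at ih ⊢
    rw [hsum, ih]

namespace Dialgebra

variable {D : Type*} [AddCommGroup D] [Module ℚ D] (A : Dialgebra ℚ D)

/-- The dialgebra word with centre `w 0`, left factors `w 1, …, w k` and right factors
`w (k + 1), …, w 6`, both listed starting from the centre. -/
def word (k : Fin 7) (w : Fin 7 → D) : D :=
  match k with
  | 0 => A.l (A.l (A.l (A.l (A.l (A.l (w 0) (w 1)) (w 2)) (w 3)) (w 4)) (w 5)) (w 6)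
  | 1 => A.r (w 1) (A.l (A.l (A.l (A.l (A.l (w 0) (w 2)) (w 3)) (w 4)) (w 5)) (w 6))
  | 2 => A.r (w 2) (A.r (w 1) (A.l (A.l (A.l (A.l (w 0) (w 3)) (w 4)) (w 5)) (w 6)))
  | 3 => A.r (w 3) (A.r (w 2) (A.r (w 1) (A.l (A.l (A.l (w 0) (w 4)) (w 5)) (w 6))))
  | 4 => A.r (w 4) (A.r (w 3) (A.r (w 2) (A.r (w 1) (A.l (A.l (w 0) (w 5)) (w 6)))))
  | 5 => A.r (w 5) (A.r (w 4) (A.r (w 3) (A.r (w 2) (A.r (w 1) (A.l (w 0) (w 6))))))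
  | 6 => A.r (w 6) (A.r (w 5) (A.r (w 4) (A.r (w 3) (A.r (w 2) (A.r (w 1) (w 0))))))

/-- Half of the PATS: `[a,b,c] = halfPats a b c - halfPats a c b`. -/
def halfPats (a b c : D) : D := A.l (A.l a b) c + A.r b (A.r c a) - A.l (A.r b a) c

theorem pats_eq (a b c : D) : A.pats a b c = A.halfPats a b c - A.halfPats a c b := by
  simp only [pats, halfPats]
  abel

theorem l_l (a b c : D) : A.l a (A.l b c) = A.l (A.l a b) c := (A.l_assoc a b c).symm

theorem l_r (a b c : D) : A.l a (A.r b c) = A.l (A.l a b) c := by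
  rw [← A.bar_left, l_l]

theorem r_l (a b c : D) : A.r (A.l a b) c = A.r a (A.r b c) := by
  rw [A.bar_right, A.r_assoc]

end Dialgebra

/-- The arrangements, up to the symmetries of the association type `t`, in which a monomial of
type `t` contributes to words with `k` letters on the left of the centre. -/
def arrangements (t : Fin 5) (k : Fin 7) : List (Equiv.Perm (Fin 7)) :=
  match t, k with
  | 0, 0 => [permOf ![0, 1, 2, 3, 4, 5, 6] ![0, 1, 2, 3, 4, 5, 6]]
  | 0, 1 => [permOf ![0, 5, 1, 2, 3, 4, 6] ![0, 2, 3, 4, 5, 1, 6],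
      permOf ![0, 3, 1, 2, 4, 5, 6] ![0, 2, 3, 1, 4, 5, 6],
      permOf ![0, 1, 2, 3, 4, 5, 6] ![0, 1, 2, 3, 4, 5, 6]]
  | 0, 2 => [permOf ![0, 6, 5, 1, 2, 3, 4] ![0, 3, 4, 5, 6, 2, 1],
      permOf ![0, 4, 3, 1, 2, 5, 6] ![0, 3, 4, 2, 1, 5, 6],
      permOf ![0, 3, 5, 1, 2, 4, 6] ![0, 3, 4, 1, 5, 2, 6],
      permOf ![0, 2, 1, 3, 4, 5, 6] ![0, 2, 1, 3, 4, 5, 6],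
      permOf ![0, 1, 5, 2, 3, 4, 6] ![0, 1, 3, 4, 5, 2, 6],
      permOf ![0, 1, 3, 2, 4, 5, 6] ![0, 1, 3, 2, 4, 5, 6]]
  | 0, 3 => [permOf ![0, 4, 3, 5, 1, 2, 6] ![0, 4, 5, 2, 1, 3, 6],
      permOf ![0, 3, 6, 5, 1, 2, 4] ![0, 4, 5, 1, 6, 3, 2],
      permOf ![0, 2, 1, 5, 3, 4, 6] ![0, 2, 1, 4, 5, 3, 6],
      permOf ![0, 2, 1, 3, 4, 5, 6] ![0, 2, 1, 3, 4, 5, 6],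
      permOf ![0, 1, 6, 5, 2, 3, 4] ![0, 1, 4, 5, 6, 3, 2],
      permOf ![0, 1, 4, 3, 2, 5, 6] ![0, 1, 4, 3, 2, 5, 6],
      permOf ![0, 1, 3, 5, 2, 4, 6] ![0, 1, 4, 2, 5, 3, 6]]
  | 0, 4 => [permOf ![0, 4, 3, 6, 5, 1, 2] ![0, 5, 6, 2, 1, 4, 3],
      permOf ![0, 2, 1, 6, 5, 3, 4] ![0, 2, 1, 5, 6, 4, 3],
      permOf ![0, 2, 1, 4, 3, 5, 6] ![0, 2, 1, 4, 3, 5, 6],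
      permOf ![0, 2, 1, 3, 5, 4, 6] ![0, 2, 1, 3, 5, 4, 6],
      permOf ![0, 1, 4, 3, 5, 2, 6] ![0, 1, 5, 3, 2, 4, 6],
      permOf ![0, 1, 3, 6, 5, 2, 4] ![0, 1, 5, 2, 6, 4, 3]]
  | 0, 5 => [permOf ![0, 2, 1, 4, 3, 5, 6] ![0, 2, 1, 4, 3, 5, 6],
      permOf ![0, 2, 1, 3, 6, 5, 4] ![0, 2, 1, 3, 6, 5, 4],
      permOf ![0, 1, 4, 3, 6, 5, 2] ![0, 1, 6, 3, 2, 5, 4]]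
  | 0, 6 => [permOf ![0, 2, 1, 4, 3, 6, 5] ![0, 2, 1, 4, 3, 6, 5]]
  | 1, 0 => [permOf ![0, 1, 2, 3, 4, 5, 6] ![0, 1, 2, 3, 4, 5, 6],
      permOf ![0, 4, 1, 2, 3, 5, 6] ![0, 2, 3, 4, 1, 5, 6]]
  | 1, 1 => [permOf ![0, 5, 1, 2, 3, 4, 6] ![0, 2, 3, 4, 5, 1, 6],
      permOf ![0, 5, 4, 1, 2, 3, 6] ![0, 3, 4, 5, 2, 1, 6],
      permOf ![0, 4, 1, 2, 3, 5, 6] ![0, 2, 3, 4, 1, 5, 6]]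
  | 1, 2 => [permOf ![0, 6, 5, 1, 2, 3, 4] ![0, 3, 4, 5, 6, 2, 1],
      permOf ![0, 6, 5, 4, 1, 2, 3] ![0, 4, 5, 6, 3, 2, 1],
      permOf ![0, 4, 5, 1, 2, 3, 6] ![0, 3, 4, 5, 1, 2, 6]]
  | 1, 3 => [permOf ![0, 3, 2, 1, 4, 5, 6] ![0, 3, 2, 1, 4, 5, 6],
      permOf ![0, 4, 6, 5, 1, 2, 3] ![0, 4, 5, 6, 1, 3, 2]]
  | 1, 4 => [permOf ![0, 4, 3, 2, 1, 5, 6] ![0, 4, 3, 2, 1, 5, 6],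
      permOf ![0, 3, 2, 1, 5, 4, 6] ![0, 3, 2, 1, 5, 4, 6],
      permOf ![0, 3, 2, 1, 4, 5, 6] ![0, 3, 2, 1, 4, 5, 6]]
  | 1, 5 => [permOf ![0, 4, 3, 2, 1, 5, 6] ![0, 4, 3, 2, 1, 5, 6],
      permOf ![0, 3, 2, 1, 6, 5, 4] ![0, 3, 2, 1, 6, 5, 4],
      permOf ![0, 3, 2, 1, 4, 5, 6] ![0, 3, 2, 1, 4, 5, 6]]
  | 1, 6 => [permOf ![0, 4, 3, 2, 1, 6, 5] ![0, 4, 3, 2, 1, 6, 5],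
      permOf ![0, 3, 2, 1, 4, 6, 5] ![0, 3, 2, 1, 4, 6, 5]]
  | 2, 0 => [permOf ![0, 1, 2, 3, 4, 5, 6] ![0, 1, 2, 3, 4, 5, 6],
      permOf ![0, 1, 2, 6, 3, 4, 5] ![0, 1, 2, 4, 5, 6, 3]]
  | 2, 1 => [permOf ![0, 1, 2, 3, 4, 5, 6] ![0, 1, 2, 3, 4, 5, 6],
      permOf ![0, 6, 1, 2, 3, 4, 5] ![0, 2, 3, 4, 5, 6, 1],
      permOf ![0, 1, 2, 6, 3, 4, 5] ![0, 1, 2, 4, 5, 6, 3]]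
  | 2, 2 => [permOf ![0, 2, 1, 3, 4, 5, 6] ![0, 2, 1, 3, 4, 5, 6],
      permOf ![0, 2, 1, 6, 3, 4, 5] ![0, 2, 1, 4, 5, 6, 3],
      permOf ![0, 1, 6, 2, 3, 4, 5] ![0, 1, 3, 4, 5, 6, 2]]
  | 2, 3 => [permOf ![0, 5, 4, 3, 1, 2, 6] ![0, 4, 5, 3, 2, 1, 6],
      permOf ![0, 2, 1, 6, 3, 4, 5] ![0, 2, 1, 4, 5, 6, 3]]
  | 2, 4 => [permOf ![0, 6, 5, 4, 3, 1, 2] ![0, 5, 6, 4, 3, 2, 1],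
      permOf ![0, 1, 5, 4, 3, 2, 6] ![0, 1, 5, 4, 3, 2, 6],
      permOf ![0, 5, 4, 3, 6, 1, 2] ![0, 5, 6, 3, 2, 1, 4]]
  | 2, 5 => [permOf ![0, 2, 1, 5, 4, 3, 6] ![0, 2, 1, 5, 4, 3, 6],
      permOf ![0, 1, 6, 5, 4, 3, 2] ![0, 1, 6, 5, 4, 3, 2],
      permOf ![0, 1, 5, 4, 3, 6, 2] ![0, 1, 6, 4, 3, 2, 5]]
  | 2, 6 => [permOf ![0, 2, 1, 6, 5, 4, 3] ![0, 2, 1, 6, 5, 4, 3],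
      permOf ![0, 2, 1, 5, 4, 3, 6] ![0, 2, 1, 5, 4, 3, 6]]
  | 3, 0 => [permOf ![0, 1, 2, 3, 4, 5, 6] ![0, 1, 2, 3, 4, 5, 6],
      permOf ![0, 6, 1, 2, 3, 4, 5] ![0, 2, 3, 4, 5, 6, 1],
      permOf ![0, 4, 5, 1, 2, 3, 6] ![0, 3, 4, 5, 1, 2, 6],
      permOf ![0, 6, 4, 5, 1, 2, 3] ![0, 4, 5, 6, 2, 3, 1],
      permOf ![0, 4, 1, 2, 3, 5, 6] ![0, 2, 3, 4, 1, 5, 6],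
      permOf ![0, 6, 4, 1, 2, 3, 5] ![0, 3, 4, 5, 2, 6, 1]]
  | 3, 1 => [permOf ![0, 6, 1, 2, 3, 4, 5] ![0, 2, 3, 4, 5, 6, 1],
      permOf ![0, 6, 4, 5, 1, 2, 3] ![0, 4, 5, 6, 2, 3, 1],
      permOf ![0, 6, 4, 1, 2, 3, 5] ![0, 3, 4, 5, 2, 6, 1]]
  | 3, 5 => [permOf ![0, 5, 4, 3, 2, 1, 6] ![0, 5, 4, 3, 2, 1, 6],
      permOf ![0, 3, 2, 1, 5, 4, 6] ![0, 3, 2, 1, 5, 4, 6],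
      permOf ![0, 5, 3, 2, 1, 4, 6] ![0, 4, 3, 2, 5, 1, 6]]
  | 3, 6 => [permOf ![0, 6, 5, 4, 3, 2, 1] ![0, 6, 5, 4, 3, 2, 1],
      permOf ![0, 5, 4, 3, 2, 1, 6] ![0, 5, 4, 3, 2, 1, 6],
      permOf ![0, 6, 3, 2, 1, 5, 4] ![0, 4, 3, 2, 6, 5, 1],
      permOf ![0, 3, 2, 1, 5, 4, 6] ![0, 3, 2, 1, 5, 4, 6],
      permOf ![0, 6, 5, 3, 2, 1, 4] ![0, 5, 4, 3, 6, 2, 1],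
      permOf ![0, 5, 3, 2, 1, 4, 6] ![0, 4, 3, 2, 5, 1, 6]]
  | 4, 0 => [permOf ![0, 1, 2, 3, 4, 5, 6] ![0, 1, 2, 3, 4, 5, 6]]
  | 4, 3 => [permOf ![0, 3, 2, 1, 4, 5, 6] ![0, 3, 2, 1, 4, 5, 6]]
  | 4, 6 => [permOf ![0, 6, 5, 4, 3, 2, 1] ![0, 6, 5, 4, 3, 2, 1]]
  | _, _ => []

/-- The sign attached to words with `k` letters on the left. -/
def leftSign (k : Fin 7) : ℚ :=
  match k with
  | 0 => 1
  | 1 => -1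
  | 2 => -1
  | 3 => 1
  | 4 => 1
  | 5 => -1
  | 6 => -1

theorem altSum_eq {D : Type*} [AddCommGroup D] [Module ℚ D] (H : List (Equiv.Perm (Fin 7)))
    (F : (Fin 7 → D) → D) (w : Fin 7 → D) (ε : List ℤ)
    (hε : H.map (fun h => (Equiv.Perm.sign h : ℤ)) = ε) :
    altSum H F w
      = (List.zipWith (fun (e : ℤ) (h : Equiv.Perm (Fin 7)) => e • F (w ∘ ⇑h)) ε H).sum := by
  subst hε
  simp only [altSum, List.zipWith_map_left, List.zipWith_self]
  congr 2
  funext h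
  simp [sgn, Int.cast_smul_eq_zsmul]

namespace Dialgebra

variable {D : Type*} [AddCommGroup D] [Module ℚ D] (A : Dialgebra ℚ D)

/-- Half of the PATS with a product of three letters as second argument, alternated with the
half in which the product is the third argument. -/
def tripleHalf (a b c d e : D) : D :=
  A.l (A.l (A.l (A.l a b) c) d) e + A.r b (A.r c (A.r d (A.r e a)))
    - A.l (A.r b (A.r c (A.r d a))) e
    - (A.l (A.l (A.l (A.l a e) b) c) d + A.r e (A.r b (A.r c (A.r d a)))
      - A.l (A.l (A.l (A.r e a) b) c) d)

/-- The analogue of `tripleHalf` for a product of five letters. -/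
def quintHalf (a b c d e f g : D) : D :=
  A.l (A.l (A.l (A.l (A.l (A.l a b) c) d) e) f) g
    + A.r b (A.r c (A.r d (A.r e (A.r f (A.r g a)))))
    - A.l (A.r b (A.r c (A.r d (A.r e (A.r f a))))) g
    - (A.l (A.l (A.l (A.l (A.l (A.l a g) b) c) d) e) f
      + A.r g (A.r b (A.r c (A.r d (A.r e (A.r f a)))))
      - A.l (A.l (A.l (A.l (A.l (A.r g a) b) c) d) e) f)

/-- Representative of the monomials of type `t` modulo the symmetries of the type. -/
def representative (t : Fin 5) (w : Fin 7 → D) : D :=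
  match t with
  | 0 => A.halfPats (A.halfPats (A.halfPats (w 0) (w 1) (w 2)) (w 3) (w 4)) (w 5) (w 6)
  | 1 => A.halfPats (A.tripleHalf (w 0) (w 1) (w 2) (w 3) (w 4)) (w 5) (w 6)
  | 2 => A.tripleHalf (A.halfPats (w 0) (w 1) (w 2)) (w 3) (w 4) (w 5) (w 6)
  | 3 => A.quintHalf (w 0) (w 1) (w 2) (w 3) (w 4) (w 5) (w 6)
      + A.quintHalf (w 0) (w 4) (w 5) (w 1) (w 2) (w 3) (w 6)
      - A.quintHalf (w 0) (w 4) (w 1) (w 2) (w 3) (w 5) (w 6)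
  | 4 => A.l (A.l (A.l (A.l (A.l (A.l (w 0) (w 1)) (w 2)) (w 3)) (w 4)) (w 5)) (w 6)
      + A.r (w 1) (A.r (w 2) (A.r (w 3) (A.r (w 4) (A.r (w 5) (A.r (w 6) (w 0))))))
      - A.l (A.l (A.l (A.r (w 1) (A.r (w 2) (A.r (w 3) (w 0)))) (w 4)) (w 5)) (w 6)

theorem representative_eq (t : Fin 5) (w : Fin 7 → D) :
    A.representative t w = ∑ k, leftSign k • altSum (arrangements t k) (A.word k) w := by
  fin_cases t <;>
  simp only [Fin.sum_univ_seven, leftSign, Fin.zero_eta, Fin.mk_one, Fin.reduceFinMk] <;>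
  simp only [altSum_eq (arrangements 0 0) _ _ [1] rfl,
    altSum_eq (arrangements 0 1) _ _ [1, 1, 1] rfl,
    altSum_eq (arrangements 0 2) _ _ [-1, -1, -1, -1, -1, -1] rfl,
    altSum_eq (arrangements 0 3) _ _ [-1, -1, -1, -1, -1, -1, -1] rfl,
    altSum_eq (arrangements 0 4) _ _ [1, 1, 1, 1, 1, 1] rfl,
    altSum_eq (arrangements 0 5) _ _ [1, 1, 1] rfl, altSum_eq (arrangements 0 6) _ _ [-1] rfl,
    altSum_eq (arrangements 1 0) _ _ [1, -1] rfl, altSum_eq (arrangements 1 1) _ _ [1, -1, -1] rfl,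
    altSum_eq (arrangements 1 2) _ _ [-1, 1, 1] rfl, altSum_eq (arrangements 1 3) _ _ [-1, 1] rfl,
    altSum_eq (arrangements 1 4) _ _ [1, 1, -1] rfl,
    altSum_eq (arrangements 1 5) _ _ [1, 1, -1] rfl, altSum_eq (arrangements 1 6) _ _ [-1, 1] rfl,
    altSum_eq (arrangements 2 0) _ _ [1, -1] rfl, altSum_eq (arrangements 2 1) _ _ [1, -1, -1] rfl,
    altSum_eq (arrangements 2 2) _ _ [-1, 1, 1] rfl, altSum_eq (arrangements 2 3) _ _ [-1, 1] rfl,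
    altSum_eq (arrangements 2 4) _ _ [1, 1, -1] rfl,
    altSum_eq (arrangements 2 5) _ _ [1, 1, -1] rfl, altSum_eq (arrangements 2 6) _ _ [-1, 1] rfl,
    altSum_eq (arrangements 3 0) _ _ [1, -1, 1, -1, -1, 1] rfl,
    altSum_eq (arrangements 3 1) _ _ [-1, -1, 1] rfl,
    altSum_eq (arrangements 3 5) _ _ [1, 1, -1] rfl,
    altSum_eq (arrangements 3 6) _ _ [-1, 1, -1, 1, 1, -1] rfl,
    altSum_eq (arrangements 4 0) _ _ [1] rfl, altSum_eq (arrangements 4 3) _ _ [-1] rfl,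
    altSum_eq (arrangements 4 6) _ _ [-1] rfl, altSum_eq (arrangements 3 2) _ _ [] rfl,
    altSum_eq (arrangements 3 3) _ _ [] rfl, altSum_eq (arrangements 3 4) _ _ [] rfl,
    altSum_eq (arrangements 4 1) _ _ [] rfl, altSum_eq (arrangements 4 2) _ _ [] rfl,
    altSum_eq (arrangements 4 4) _ _ [] rfl, altSum_eq (arrangements 4 5) _ _ [] rfl] <;>
  simp only [arrangements, representative, List.zipWith, List.sum_cons, List.sum_nil, word, permOf,
    Function.comp_apply, Equiv.coe_fn_mk, Matrix.cons_val] <;>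
  simp only [halfPats, tripleHalf, quintHalf, map_add, map_sub, LinearMap.add_apply,
    LinearMap.sub_apply, A.inner_assoc, smul_zero] <;>
  module

end Dialgebra

/-- The permutations of the positions `1, 2`. -/
def alt12 : List (Equiv.Perm (Fin 7)) :=
  [permOf ![0, 1, 2, 3, 4, 5, 6] ![0, 1, 2, 3, 4, 5, 6],
    permOf ![0, 2, 1, 3, 4, 5, 6] ![0, 2, 1, 3, 4, 5, 6]]

/-- The permutations of the positions `3, 4`. -/
def alt34 : List (Equiv.Perm (Fin 7)) :=
  [permOf ![0, 1, 2, 3, 4, 5, 6] ![0, 1, 2, 3, 4, 5, 6],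
    permOf ![0, 1, 2, 4, 3, 5, 6] ![0, 1, 2, 4, 3, 5, 6]]

/-- The permutations of the positions `4, 5`. -/
def alt45 : List (Equiv.Perm (Fin 7)) :=
  [permOf ![0, 1, 2, 3, 4, 5, 6] ![0, 1, 2, 3, 4, 5, 6],
    permOf ![0, 1, 2, 3, 5, 4, 6] ![0, 1, 2, 3, 5, 4, 6]]

/-- The permutations of the positions `5, 6`. -/
def alt56 : List (Equiv.Perm (Fin 7)) :=
  [permOf ![0, 1, 2, 3, 4, 5, 6] ![0, 1, 2, 3, 4, 5, 6],
    permOf ![0, 1, 2, 3, 4, 6, 5] ![0, 1, 2, 3, 4, 6, 5]]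

/-- The permutations of the positions `1, 2, 3`. -/
def alt123 : List (Equiv.Perm (Fin 7)) :=
  [permOf ![0, 1, 2, 3, 4, 5, 6] ![0, 1, 2, 3, 4, 5, 6],
    permOf ![0, 1, 3, 2, 4, 5, 6] ![0, 1, 3, 2, 4, 5, 6],
    permOf ![0, 2, 1, 3, 4, 5, 6] ![0, 2, 1, 3, 4, 5, 6],
    permOf ![0, 2, 3, 1, 4, 5, 6] ![0, 3, 1, 2, 4, 5, 6],
    permOf ![0, 3, 1, 2, 4, 5, 6] ![0, 2, 3, 1, 4, 5, 6],
    permOf ![0, 3, 2, 1, 4, 5, 6] ![0, 3, 2, 1, 4, 5, 6]]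

/-- The permutations of the positions `3, 4, 5`. -/
def alt345 : List (Equiv.Perm (Fin 7)) :=
  [permOf ![0, 1, 2, 3, 4, 5, 6] ![0, 1, 2, 3, 4, 5, 6],
    permOf ![0, 1, 2, 3, 5, 4, 6] ![0, 1, 2, 3, 5, 4, 6],
    permOf ![0, 1, 2, 4, 3, 5, 6] ![0, 1, 2, 4, 3, 5, 6],
    permOf ![0, 1, 2, 4, 5, 3, 6] ![0, 1, 2, 5, 3, 4, 6],
    permOf ![0, 1, 2, 5, 3, 4, 6] ![0, 1, 2, 4, 5, 3, 6],
    permOf ![0, 1, 2, 5, 4, 3, 6] ![0, 1, 2, 5, 4, 3, 6]]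

/-- The permutations of the positions `4, 5, 6`. -/
def alt456 : List (Equiv.Perm (Fin 7)) :=
  [permOf ![0, 1, 2, 3, 4, 5, 6] ![0, 1, 2, 3, 4, 5, 6],
    permOf ![0, 1, 2, 3, 4, 6, 5] ![0, 1, 2, 3, 4, 6, 5],
    permOf ![0, 1, 2, 3, 5, 4, 6] ![0, 1, 2, 3, 5, 4, 6],
    permOf ![0, 1, 2, 3, 5, 6, 4] ![0, 1, 2, 3, 6, 4, 5],
    permOf ![0, 1, 2, 3, 6, 4, 5] ![0, 1, 2, 3, 5, 6, 4],
    permOf ![0, 1, 2, 3, 6, 5, 4] ![0, 1, 2, 3, 6, 5, 4]]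

/-- The identity and the exchange of the blocks of positions `1, 2, 3` and `4, 5, 6`. -/
def altBlocks : List (Equiv.Perm (Fin 7)) :=
  [permOf ![0, 1, 2, 3, 4, 5, 6] ![0, 1, 2, 3, 4, 5, 6],
    permOf ![0, 4, 5, 6, 1, 2, 3] ![0, 4, 5, 6, 1, 2, 3]]

/-- The permutations of the positions which generate, together with those of `symmetries₂` and
`symmetries₃`, the monomials of type `t` from their representative. -/
def symmetries₁ (t : Fin 5) : List (Equiv.Perm (Fin 7)) :=
  match t with
  | 0 => alt12
  | 1 => alt123
  | 2 => alt12
  | 3 => alt123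
  | 4 => altBlocks

/-- The second factor of the lists generating the monomials of type `t`, see `symmetries₁`. -/
def symmetries₂ (t : Fin 5) : List (Equiv.Perm (Fin 7)) :=
  match t with
  | 0 => alt34
  | 1 => alt56
  | 2 => alt345
  | 3 => alt45
  | 4 => alt123

/-- The third factor of the lists generating the monomials of type `t`, see `symmetries₁`. -/
def symmetries₃ (t : Fin 5) : List (Equiv.Perm (Fin 7)) :=
  match t with
  | 0 => alt56
  | 4 => alt456
  | _ => [1]

namespace Dialgebra

variable {D : Type*} [AddCommGroup D] [Module ℚ D] (A : Dialgebra ℚ D)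

/-- The monomial of association type `t` with letters `w`. -/
def monomial (t : Fin 5) (w : Fin 7 → D) : D :=
  match t with
  | 0 => A.pats (A.pats (A.pats (w 0) (w 1) (w 2)) (w 3) (w 4)) (w 5) (w 6)
  | 1 => A.pats (A.pats (w 0) (A.pats (w 1) (w 2) (w 3)) (w 4)) (w 5) (w 6)
  | 2 => A.pats (A.pats (w 0) (w 1) (w 2)) (A.pats (w 3) (w 4) (w 5)) (w 6)
  | 3 => A.pats (w 0) (A.pats (A.pats (w 1) (w 2) (w 3)) (w 4) (w 5)) (w 6)
  | 4 => A.pats (w 0) (A.pats (w 1) (w 2) (w 3)) (A.pats (w 4) (w 5) (w 6))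

theorem l_pats (m b c d : D) : A.l m (A.pats b c d)
    = A.l (A.l (A.l m b) c) d - A.l (A.l (A.l m b) d) c - A.l (A.l (A.l m c) b) d
      + A.l (A.l (A.l m c) d) b + A.l (A.l (A.l m d) b) c - A.l (A.l (A.l m d) c) b := by
  simp only [pats, map_add, map_sub, A.inner_assoc, A.l_l, A.l_r]
  abel

theorem r_pats (m b c d : D) : A.r (A.pats b c d) m
    = A.r b (A.r c (A.r d m)) - A.r b (A.r d (A.r c m)) - A.r c (A.r b (A.r d m))
      + A.r c (A.r d (A.r b m)) + A.r d (A.r b (A.r c m)) - A.r d (A.r c (A.r b m)) := by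
  simp only [pats, map_add, map_sub, LinearMap.add_apply, LinearMap.sub_apply, A.inner_assoc, A.r_l,
    A.r_assoc]
  abel

theorem halfPats_sub_left (a a' b c : D) :
    A.halfPats (a - a') b c = A.halfPats a b c - A.halfPats a' b c := by
  simp only [halfPats, map_sub, LinearMap.sub_apply]
  abel

theorem halfPats_add_left (a a' b c : D) :
    A.halfPats (a + a') b c = A.halfPats a b c + A.halfPats a' b c := by
  simp only [halfPats, map_add, LinearMap.add_apply]
  abel

theorem tripleHalf_sub_left (a a' b c d e : D) :
    A.tripleHalf (a - a') b c d e = A.tripleHalf a b c d e - A.tripleHalf a' b c d e := by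
  simp only [tripleHalf, map_sub, LinearMap.sub_apply]
  abel

theorem pats_pats (a b c d e : D) : A.pats a (A.pats b c d) e
    = A.tripleHalf a b c d e - A.tripleHalf a b d c e - A.tripleHalf a c b d e
      + A.tripleHalf a c d b e + A.tripleHalf a d b c e - A.tripleHalf a d c b e := by
  simp only [pats_eq A a, halfPats, tripleHalf, l_pats, r_pats, map_add, map_sub,
    LinearMap.add_apply, LinearMap.sub_apply]
  abel

theorem tripleHalf_pats_first (a b c d e f g : D) : A.tripleHalf a (A.pats b c d) e f g
    = A.quintHalf a b c d e f g - A.quintHalf a b d c e f g - A.quintHalf a c b d e f g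
      + A.quintHalf a c d b e f g + A.quintHalf a d b c e f g - A.quintHalf a d c b e f g := by
  simp only [quintHalf, tripleHalf, l_pats, r_pats, map_add, map_sub, LinearMap.add_apply,
    LinearMap.sub_apply]
  abel

theorem tripleHalf_pats_second (a b c d e f g : D) : A.tripleHalf a e (A.pats b c d) f g
    = A.quintHalf a e b c d f g - A.quintHalf a e b d c f g - A.quintHalf a e c b d f g
      + A.quintHalf a e c d b f g + A.quintHalf a e d b c f g - A.quintHalf a e d c b f g := by
  simp only [quintHalf, tripleHalf, l_pats, r_pats, map_add, map_sub, LinearMap.add_apply,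
    LinearMap.sub_apply]
  abel

theorem tripleHalf_pats_third (a b c d e f g : D) : A.tripleHalf a e f (A.pats b c d) g
    = A.quintHalf a e f b c d g - A.quintHalf a e f b d c g - A.quintHalf a e f c b d g
      + A.quintHalf a e f c d b g + A.quintHalf a e f d b c g - A.quintHalf a e f d c b g := by
  simp only [quintHalf, tripleHalf, l_pats, r_pats, map_add, map_sub, LinearMap.add_apply,
    LinearMap.sub_apply]
  abel

theorem monomial_eq (t : Fin 5) (w : Fin 7 → D) :
    A.monomial t w = altSum (symmetries₁ t) (altSum (symmetries₂ t)
      (altSum (symmetries₃ t) (A.representative t))) w := by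
  fin_cases t <;>
  simp only [symmetries₁, symmetries₂, symmetries₃, monomial, Fin.zero_eta, Fin.mk_one,
    Fin.reduceFinMk] <;>
  simp only [altSum_eq alt12 _ _ [1, -1] rfl, altSum_eq alt34 _ _ [1, -1] rfl,
    altSum_eq alt45 _ _ [1, -1] rfl, altSum_eq alt56 _ _ [1, -1] rfl,
    altSum_eq alt123 _ _ [1, -1, -1, 1, 1, -1] rfl, altSum_eq alt345 _ _ [1, -1, -1, 1, 1, -1] rfl,
    altSum_eq alt456 _ _ [1, -1, -1, 1, 1, -1] rfl, altSum_eq altBlocks _ _ [1, -1] rfl,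
    altSum_eq [1] _ _ [1] rfl] <;>
  simp only [alt12, alt34, alt45, alt56, alt123, alt345, alt456, altBlocks, representative,
    List.zipWith, List.sum_cons, List.sum_nil, permOf, Function.comp_apply, Equiv.coe_fn_mk,
    Equiv.Perm.coe_one, id_eq, Matrix.cons_val]
  · simp only [pats_eq, halfPats_sub_left]
    module
  · simp only [pats_pats, pats_eq A (_ - _), halfPats_sub_left, halfPats_add_left]
    module
  · simp only [pats_pats, pats_eq A (w 0), tripleHalf_sub_left]
    module
  · simp only [pats_pats, tripleHalf_pats_first, tripleHalf_pats_second, tripleHalf_pats_third]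
    module
  · simp only [pats_eq A (w 0), halfPats, l_pats, r_pats, map_add, map_sub, LinearMap.add_apply,
      LinearMap.sub_apply]
    simp only [one_smul, neg_smul, smul_add, smul_sub, smul_neg]
    abel

end Dialgebra

/-- Values of a coefficient function at words, symmetrized over the symmetries of each type. -/
def symmetrize (G : Fin 5 → (Fin 7 → Fin 7) → ℚ) (t : Fin 5) : (Fin 7 → Fin 7) → ℚ :=
  symSum (symmetries₃ t) (symSum (symmetries₂ t) (symSum (symmetries₁ t) (G t)))

/-- Up to sign, the coefficient of the word with `k` letters on the left and letters `w` in the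
combination of monomials whose coefficients are given by `G`. -/
def wordCoef (G : Fin 5 → (Fin 7 → Fin 7) → ℚ) (k : Fin 7) (w : Fin 7 → Fin 7) : ℚ :=
  ∑ t, symSum (arrangements t k) (symmetrize G t) w

/-- The coefficients of `x`, corrected by signs and extended by zero to all words. -/
noncomputable def signedCoef (x : Mon7 → ℚ) (t : Fin 5) (w : Fin 7 → Fin 7) : ℚ :=
  Function.extend (fun m : Mon7 => (m.1.1, (⇑m.1.2 : Fin 7 → Fin 7)))
    (fun m => sgn m.1.2 * x m) 0 (t, w)

theorem mon7_key_injective :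
    Function.Injective (fun m : Mon7 => (m.1.1, (⇑m.1.2 : Fin 7 → Fin 7))) := by
  intro m n h
  rw [Prod.mk.injEq] at h
  exact Subtype.ext (Prod.ext h.1 (DFunLike.coe_injective h.2))

theorem signedCoef_apply (x : Mon7 → ℚ) (m : Mon7) :
    signedCoef x m.1.1 m.1.2 = sgn m.1.2 * x m :=
  mon7_key_injective.extend_apply _ _ m

theorem signedCoef_eq_zero (x : Mon7 → ℚ) (t : Fin 5) (w : Fin 7 → Fin 7)
    (h : ∀ m : Mon7, m.1.1 = t → ⇑m.1.2 ≠ w) : signedCoef x t w = 0 := by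
  refine Function.extend_apply' _ _ _ ?_
  rintro ⟨m, hm⟩
  rw [Prod.mk.injEq] at hm
  exact h m hm.1 hm.2

theorem evalMon7_eq {D : Type} [AddCommGroup D] [Module ℚ D] (A : Dialgebra ℚ D)
    (v : Fin 7 → D) (m : Mon7) : evalMon7 A v m = A.monomial m.1.1 (v ∘ m.1.2) := by
  obtain ⟨⟨t, π⟩, h⟩ := m
  fin_cases t <;> rfl

theorem sum_smul_evalMon7 {D : Type} [AddCommGroup D] [Module ℚ D] (A : Dialgebra ℚ D)
    (v : Fin 7 → D) (x : Mon7 → ℚ) :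
    ∑ m : Mon7, x m • evalMon7 A v m = ∑ k, leftSign k •
      ∑ π : Equiv.Perm (Fin 7), (sgn π * wordCoef (signedCoef x) k π) • A.word k (v ∘ π) := by
  have h₁ : ∑ m : Mon7, x m • evalMon7 A v m = ∑ p : Fin 5 × Equiv.Perm (Fin 7),
      (sgn p.2 * signedCoef x p.1 p.2) • A.monomial p.1 (v ∘ p.2) := by
    refine Fintype.sum_of_injective (fun m : Mon7 => m.1) Subtype.val_injective _ _ ?_ ?_
    · intro p hp
      rw [signedCoef_eq_zero, mul_zero, zero_smul]
      intro m hm hm'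
      exact hp ⟨m, Prod.ext hm (DFunLike.coe_injective hm')⟩
    · intro (m : Mon7)
      rw [evalMon7_eq, signedCoef_apply, ← mul_assoc, sgn_mul_self, one_mul]
  have h₂ (t : Fin 5) : ∑ π : Equiv.Perm (Fin 7),
      (sgn π * signedCoef x t π) • A.monomial t (v ∘ π)
        = ∑ k, leftSign k • ∑ π : Equiv.Perm (Fin 7),
          (sgn π * symSum (arrangements t k) (symmetrize (signedCoef x) t) π)
            • A.word k (v ∘ π) := by
    simp only [A.monomial_eq, sum_smul_altSum]
    simp only [A.representative_eq, Finset.smul_sum]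
    rw [Finset.sum_comm]
    refine Finset.sum_congr rfl fun k _ => ?_
    rw [← Finset.smul_sum, ← sum_smul_altSum, Finset.smul_sum]
    exact Finset.sum_congr rfl fun π _ => smul_comm _ _ _
  rw [h₁, Fintype.sum_prod_type, Finset.sum_congr rfl fun t _ => h₂ t, Finset.sum_comm]
  refine Finset.sum_congr rfl fun k _ => ?_
  rw [← Finset.smul_sum, Finset.sum_comm]
  congr 1
  refine Finset.sum_congr rfl fun π _ => ?_
  rw [wordCoef, Finset.mul_sum, Finset.sum_smul]

theorem symSum_eq_zero {G : (Fin 7 → Fin 7) → ℚ} (H : List (Equiv.Perm (Fin 7)))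
    (hG : ∀ w, ¬ Function.Injective w → G w = 0) (w : Fin 7 → Fin 7)
    (hw : ¬ Function.Injective w) : symSum H G w = 0 := by
  refine List.sum_eq_zero fun q hq => ?_
  obtain ⟨h, -, rfl⟩ := List.mem_map.1 hq
  exact hG _ fun hi => hw ((Equiv.injective_comp h⁻¹ w).1 hi)

theorem wordCoef_signedCoef_eq_zero (x : Mon7 → ℚ) (k : Fin 7)
    (hx : ∀ π : Equiv.Perm (Fin 7), wordCoef (signedCoef x) k π = 0) (w : Fin 7 → Fin 7) :
    wordCoef (signedCoef x) k w = 0 := by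
  by_cases hw : Function.Injective w
  · exact hx (Equiv.ofBijective w (Finite.injective_iff_bijective.1 hw))
  · refine Finset.sum_eq_zero fun t _ => symSum_eq_zero _ (symSum_eq_zero _ (symSum_eq_zero _
      (symSum_eq_zero _ fun w hw => signedCoef_eq_zero _ _ _ ?_))) w hw
    rintro m - rfl
    exact hw m.1.2.injective

/-- Functions `y₀, …, y₄` of six letters with the symmetries of the five association types, subject
to the linear equations expressing that words with zero, one, two or three letters to the left of
the centre have coefficient zero. -/
structure WordSystem (α : Type*) where
  y0 : α → α → α → α → α → α → ℚ
  y1 : α → α → α → α → α → α → ℚ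
  y2 : α → α → α → α → α → α → ℚ
  y3 : α → α → α → α → α → α → ℚ
  y4 : α → α → α → α → α → α → ℚ
  y0_swap01 : ∀ a b c d e f, y0 a b c d e f = y0 b a c d e f
  y0_swap23 : ∀ a b c d e f, y0 a b c d e f = y0 a b d c e f
  y0_swap45 : ∀ a b c d e f, y0 a b c d e f = y0 a b c d f e
  y1_swap01 : ∀ a b c d e f, y1 a b c d e f = y1 b a c d e f
  y1_swap12 : ∀ a b c d e f, y1 a b c d e f = y1 a c b d e f
  y1_swap45 : ∀ a b c d e f, y1 a b c d e f = y1 a b c d f e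
  y2_swap01 : ∀ a b c d e f, y2 a b c d e f = y2 b a c d e f
  y2_swap23 : ∀ a b c d e f, y2 a b c d e f = y2 a b d c e f
  y2_swap34 : ∀ a b c d e f, y2 a b c d e f = y2 a b c e d f
  y3_swap01 : ∀ a b c d e f, y3 a b c d e f = y3 b a c d e f
  y3_swap12 : ∀ a b c d e f, y3 a b c d e f = y3 a c b d e f
  y3_swap34 : ∀ a b c d e f, y3 a b c d e f = y3 a b c e d f
  y4_swap01 : ∀ a b c d e f, y4 a b c d e f = y4 b a c d e f
  y4_swap12 : ∀ a b c d e f, y4 a b c d e f = y4 a c b d e f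
  y4_block : ∀ a b c d e f, y4 a b c d e f = y4 d e f a b c
  eq0 : ∀ a b c d e f, y0 a b c d e f + y2 a b c d e f + y2 a b d e f c + y1 a b c d e f
    + y1 b c d a e f + y3 a b c d e f + y3 b c d a e f + y3 c d e a b f + y3 b c d e f a
    + y3 c d e b f a + y3 d e f b c a + y4 a b c d e f = 0
  eq1 : ∀ a b c d e f, y0 b c d e a f + y0 b c a d e f + y0 a b c d e f + y1 b c d e a f
    + y1 c d e b a f + y1 b c d a e f + y2 b c d e f a + y2 a b c d e f + y2 a b d e f c
    + y3 b c d e f a + y3 c d e b f a + y3 d e f b c a = 0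
  eq2 : ∀ a b c d e f, y0 c d e f a b + y0 c d a b e f + y0 c d a e b f + y0 a b c d e f
    + y0 a c d e b f + y0 a c b d e f + y2 a b c d e f + y2 a b d e f c + y2 a c d e f b
    + y1 c d e f a b + y1 d e f c a b + y1 c d e a b f = 0
  eq3 : ∀ a b c d e f, y0 d e a b c f + y0 d e a f b c + y0 a b d e c f + y0 a b c d e f
    + y0 a d e f b c + y0 a d b c e f + y0 a d b e c f + y2 d e a b c f + y2 a b d e f c
    + y1 d e f a b c + y1 a b c d e f + y4 a b c d e f = 0

namespace WordSystem

variable {α : Type*} (S : WordSystem α)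

/-- The excess of `y₁` over `y₂`. -/
def p (a b c d e f : α) : ℚ := S.y1 a b c d e f - S.y2 e f a b c d

theorem y1_eq (a b c d e f : α) : S.y1 a b c d e f = S.y2 e f a b c d + S.p a b c d e f := by
  simp [p]

theorem p_swap01 (a b c d e f : α) : S.p a b c d e f = S.p b a c d e f := by
  rw [p, p, S.y1_swap01, S.y2_swap23]

theorem p_swap12 (a b c d e f : α) : S.p a b c d e f = S.p a c b d e f := by
  rw [p, p, S.y1_swap12, S.y2_swap34]

theorem p_swap45 (a b c d e f : α) : S.p a b c d e f = S.p a b c d f e := by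
  rw [p, p, S.y1_swap45, S.y2_swap01]

theorem p_add_p (a b c d e f : α) :
    S.p a b c d e f + S.p b c d a e f - S.p d e f c a b - S.p c d e f a b
      = S.y0 e f c d a b - S.y0 a b c d e f := by
  have h1 := S.eq0 a b c d e f
  have h2 := S.eq0 f e d c b a
  simp only [y1_eq, S.y0_swap01, S.y0_swap23, S.y0_swap45, S.y2_swap01, S.y2_swap23, S.y2_swap34,
    S.y3_swap01, S.y3_swap12, S.y3_swap34, S.y4_swap01, S.y4_swap12, S.y4_block, S.p_swap01,
    S.p_swap12, S.p_swap45] at h1 h2 ⊢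
  linear_combination h1 - h2

theorem p_swap23 (a b c d e f : α) : S.p a b c d e f = S.p a b d c e f := by
  have h1 := S.p_add_p c d a b e f
  have h2 := S.p_add_p d c a b e f
  simp only [S.p_swap01, S.p_swap12, S.p_swap45, S.y0_swap01, S.y0_swap45]
    at h1 h2 ⊢
  linear_combination h2 - h1

theorem y0_sub_y0 (a b c d e f : α) :
    S.y0 a b c d e f - S.y0 e f c d a b = 2 * S.p c d e f a b - 2 * S.p a b c d e f := by
  have h := S.p_add_p a b c d e f
  simp only [S.p_swap01, S.p_swap12, S.p_swap23] at h ⊢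
  linear_combination h

theorem p_rotate (a b c d e f : α) : S.p a d e f b c = S.p a b c d e f := by
  have h1 := S.eq1 a b c d e f
  have h2 := S.eq1 a f e d c b
  have h3 := S.y0_sub_y0 b c d e a f
  have h4 := S.y0_sub_y0 b c a d e f
  have h5 := S.y0_sub_y0 a b c d e f
  simp only [y1_eq, S.y0_swap01, S.y0_swap23, S.y0_swap45, S.y2_swap01, S.y2_swap23, S.y2_swap34,
    S.y3_swap01, S.y3_swap12, S.y3_swap34, S.p_swap01, S.p_swap12, S.p_swap45, S.p_swap23]
    at h1 h2 h3 h4 h5 ⊢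
  linear_combination (h1 - h2 - h3 - h4 - h5) / 3

theorem p_swap34 (a b c d e f : α) : S.p a b c d e f = S.p a b c e d f := by
  have h1 := S.p_rotate a b c d e f
  have h2 := S.p_rotate a b c e d f
  simp only [S.p_swap12] at h1 h2 ⊢
  linear_combination h2 - h1

theorem y0_outer (a b c d e f : α) : S.y0 a b c d e f = S.y0 e f c d a b := by
  have h := S.y0_sub_y0 a b c d e f
  simp only [S.p_swap01, S.p_swap12, S.p_swap23, S.p_swap34, S.p_swap45] at h
  linear_combination h

theorem y0_exchange (a b c d e f : α) :
    S.y0 c d a b e f + S.y0 a b c d e f + S.y0 c d e f a b + S.y0 c d a e b f + S.y0 a c b d e f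
      = S.y0 c e a b d f + S.y0 a b c e d f + S.y0 c e d f a b + S.y0 c e a d b f
        + S.y0 a c b e d f := by
  have h1 := S.eq2 a b c d e f
  have h2 := S.eq2 a b c e d f
  simp only [y1_eq, S.y0_swap23, S.y0_outer, S.y2_swap23, S.y2_swap34, S.p_swap01, S.p_swap12,
    S.p_swap23, S.p_swap34, S.p_swap45] at h1 h2 ⊢
  linear_combination h1 - h2

theorem y0_swap15 (a b c d e f : α) : S.y0 a b c d e f = S.y0 a f c d e b := by
  have h0 := S.y0_exchange c e a d b f
  have h1 := S.y0_exchange e d c f b a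
  have h2 := S.y0_exchange a c f d b e
  have h3 := S.y0_exchange c b f d e a
  have h4 := S.y0_exchange c f b d a e
  have h5 := S.y0_exchange f c a e d b
  have h6 := S.y0_exchange d e a c f b
  have h7 := S.y0_exchange c a e d f b
  have h8 := S.y0_exchange c e a d f b
  have h9 := S.y0_exchange f d a c e b
  have h10 := S.y0_exchange c b f d a e
  have h11 := S.y0_exchange d f b e a c
  have h12 := S.y0_exchange e d f c b a
  have h13 := S.y0_exchange d f b a c e
  simp only [S.y0_swap01, S.y0_swap23, S.y0_swap45, S.y0_outer]
    at h0 h1 h2 h3 h4 h5 h6 h7 h8 h9 h10 h11 h12 h13 ⊢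
  linear_combination (- h0 - h1 - h2 - h3 - h4 + h5 + h6 - h7 + h8 - h9 + h10 + h11 + h12 + h13) / 6

/-- The value of `y₀` as a function of its middle pair. -/
def z (a b c d e f : α) : ℚ := S.y0 c d a b e f

theorem y0_eq_z (a b c d e f : α) : S.y0 a b c d e f = S.z c d a b e f := rfl

theorem z_swap01 (a b c d e f : α) : S.z a b c d e f = S.z b a c d e f :=
  S.y0_swap23 ..

theorem z_swap23 (a b c d e f : α) : S.z a b c d e f = S.z a b d c e f :=
  S.y0_swap01 ..

theorem z_swap45 (a b c d e f : α) : S.z a b c d e f = S.z a b c d f e :=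
  S.y0_swap45 ..

theorem z_swap34 (a b c d e f : α) : S.z a b c d e f = S.z a b c e d f := by
  have h := S.y0_swap15 c d a b f e
  rw [S.y0_swap45, S.y0_swap45 c e] at h
  exact h

theorem z_add_z (a b c d e f : α) :
    S.z a b c d e f + S.z c d a b e f = S.z b c a d e f + S.z a d b c e f := by
  have h1 := S.y0_exchange e f d a c b
  have h2 := S.y0_exchange f d e a c b
  simp only [y0_eq_z, S.z_swap01, S.z_swap23, S.z_swap34, S.z_swap45] at h1 h2 ⊢
  linear_combination -(h1 + h2) / 2

/-- The contribution of a single letter to `z`. -/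
def s (a b c d e f : α) : ℚ := (S.z a b c d e f + S.z a c b d e f - S.z b c a d e f) / 2

theorem s_swap12 (a b c d e f : α) : S.s a b c d e f = S.s a c b d e f := by
  simp only [s, S.z_swap01]
  ring

theorem s_swap23 (a b c d e f : α) : S.s a b c d e f = S.s a b d c e f := by
  have h := S.z_add_z a c b d e f
  simp only [s, S.z_swap01, S.z_swap23] at h ⊢
  linear_combination h / 2

theorem s_swap34 (a b c d e f : α) : S.s a b c d e f = S.s a b c e d f := by
  simp only [s, S.z_swap34]

theorem s_swap45 (a b c d e f : α) : S.s a b c d e f = S.s a b c d f e := by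
  simp only [s, S.z_swap45]

theorem z_eq_s_add_s (a b c d e f : α) :
    S.z a b c d e f = S.s a b c d e f + S.s b a c d e f := by
  simp only [s, S.z_swap01]
  ring

theorem y2_swap12 (a b c d e f : α) : S.y2 a b c d e f = S.y2 a c b d e f := by
  have h0 := S.eq2 a f c d e b
  have h1 := S.eq2 c a f e d b
  have h2 := S.eq2 b a f c e d
  have h3 := S.eq2 b a c e f d
  have h4 := S.eq2 a c d b e f
  have h5 := S.eq2 a c d e f b
  have h6 := S.eq2 a f b d e c
  have h7 := S.eq2 b a f d e c
  simp only [y1_eq, y0_eq_z, z_eq_s_add_s, S.s_swap12, S.s_swap23, S.s_swap34, S.s_swap45,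
    S.y2_swap01, S.y2_swap23, S.y2_swap34, S.p_swap01, S.p_swap12, S.p_swap23, S.p_swap34,
    S.p_swap45] at h0 h1 h2 h3 h4 h5 h6 h7 ⊢
  linear_combination (-1/3) * h0 + (-2/9) * h1 + (1/9) * h2 + (-1/9) * h3 + (-1/9) * h4 + (1/9) * h5
    + (1/3) * h6 + (2/9) * h7

theorem two_mul_y2 (a b c d e f : α) :
    2 * S.y2 a b c d e f = 2 * S.s f a b c d e - (S.p a b c d e f + S.s a b c d e f
      + S.s b a c d e f + S.s c a b d e f + S.s d a b c e f + S.s e a b c d f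
      + S.s f a b c d e) := by
  have h0 := S.eq2 c e f b a d
  have h1 := S.eq2 a d f e b c
  have h2 := S.eq2 e d c f b a
  have h3 := S.eq2 e c a d b f
  simp only [y1_eq, y0_eq_z, z_eq_s_add_s, S.s_swap12, S.s_swap23, S.s_swap34, S.s_swap45,
    S.y2_swap01, S.y2_swap23, S.y2_swap34, S.y2_swap12, S.p_swap01, S.p_swap12, S.p_swap23,
    S.p_swap34, S.p_swap45] at h0 h1 h2 h3 ⊢
  linear_combination (1/6) * h0 + (1/3) * h1 + (-2/3) * h2 + (1/2) * h3

/-- The part of `y₂` independent of the order of the letters. -/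
def r (a b c d e f : α) : ℚ :=
  (S.p a b c d e f + S.s a b c d e f + S.s b a c d e f + S.s c a b d e f + S.s d a b c e f
    + S.s e a b c d f + S.s f a b c d e) / 2

theorem r_swap01 (a b c d e f : α) : S.r a b c d e f = S.r b a c d e f := by
  simp only [r, S.p_swap01, S.s_swap12]
  ring

theorem r_swap12 (a b c d e f : α) : S.r a b c d e f = S.r a c b d e f := by
  simp only [r, S.p_swap12, S.s_swap12, S.s_swap23]
  ring

theorem r_swap23 (a b c d e f : α) : S.r a b c d e f = S.r a b d c e f := by
  simp only [r, S.p_swap23, S.s_swap23, S.s_swap34]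
  ring

theorem r_swap34 (a b c d e f : α) : S.r a b c d e f = S.r a b c e d f := by
  simp only [r, S.p_swap34, S.s_swap34, S.s_swap45]
  ring

theorem r_swap45 (a b c d e f : α) : S.r a b c d e f = S.r a b c d f e := by
  simp only [r, S.p_swap45, S.s_swap45]
  ring

theorem y0_eq (a b c d e f : α) :
    S.y0 a b c d e f = S.s c a b d e f + S.s d a b c e f := by
  simp only [y0_eq_z, z_eq_s_add_s, S.s_swap12, S.s_swap23]

theorem y2_eq (a b c d e f : α) : S.y2 a b c d e f = S.s f a b c d e - S.r a b c d e f := by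
  rw [r]
  linear_combination S.two_mul_y2 a b c d e f / 2

theorem p_eq (a b c d e f : α) :
    S.p a b c d e f = 2 * S.r a b c d e f - (S.s a b c d e f + S.s b a c d e f + S.s c a b d e f
      + S.s d a b c e f + S.s e a b c d f + S.s f a b c d e) := by
  rw [r]
  ring

theorem y1_eq_s_add_r (a b c d e f : α) :
    S.y1 a b c d e f = S.r a b c d e f - (S.s a b c d e f + S.s b a c d e f + S.s c a b d e f
      + S.s e a b c d f + S.s f a b c d e) := by
  simp only [y1_eq, p_eq, y2_eq, S.s_swap12, S.s_swap23, S.s_swap34, S.s_swap45, S.r_swap01,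
    S.r_swap12, S.r_swap23, S.r_swap34, S.r_swap45]
  ring

theorem y4_eq (a b c d e f : α) :
    S.y4 a b c d e f = -(S.s a b c d e f + S.s b a c d e f + S.s c a b d e f
      + S.s d a b c e f + S.s e a b c d f + S.s f a b c d e) := by
  have h := S.eq3 a b c d e f
  simp only [y0_eq, y1_eq_s_add_r, y2_eq, S.s_swap12, S.s_swap23, S.s_swap34, S.s_swap45,
    S.r_swap01, S.r_swap12, S.r_swap23, S.r_swap34, S.r_swap45] at h ⊢
  linear_combination h

theorem y3_path (a b c d e f : α) :
    S.y3 b c d e f a + S.y3 c d e b f a + S.y3 d e f b c a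
      = S.s e a b c d f + 2 * S.s f a b c d e + 2 * S.s b a c d e f + S.s c a b d e f := by
  have h := S.eq1 a b c d e f
  simp only [y0_eq, y1_eq_s_add_r, y2_eq, S.s_swap12, S.s_swap23, S.s_swap34, S.s_swap45,
    S.r_swap01, S.r_swap12, S.r_swap23, S.r_swap34, S.r_swap45] at h ⊢
  linear_combination h

theorem y3_eq (a b c d e f : α) :
    S.y3 a b c d e f = S.s d a b c e f + S.s e a b c d f := by
  have h1 := S.y3_path f a b c d e
  have h2 := S.y3_path f b d c e a
  have h3 := S.y3_path f d e c a b
  have h4 := S.y3_path f e a c b d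
  simp only [S.y3_swap01, S.y3_swap12, S.y3_swap34, S.s_swap12, S.s_swap23, S.s_swap34,
    S.s_swap45] at h1 h2 h3 h4 ⊢
  linear_combination (h1 - 2 * h2 + h3 + h4) / 3

end WordSystem

theorem comp_permOf_inv (f g : Fin 7 → Fin 7) (h : ∀ i, g (f i) = i ∧ f (g i) = i)
    {α : Type*} (w : Fin 7 → α) :
    w ∘ ⇑(permOf f g h)⁻¹
      = ![w (g 0), w (g 1), w (g 2), w (g 3), w (g 4), w (g 5), w (g 6)] := by
  funext i
  fin_cases i <;> rfl

section SymSum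

variable (F : (Fin 7 → Fin 7) → ℚ) (o a b c d e f : Fin 7)

theorem symSum_alt12 : symSum alt12 F ![o, a, b, c, d, e, f]
    = F ![o, a, b, c, d, e, f] + F ![o, b, a, c, d, e, f] := by
  simp only [symSum, alt12, List.map_cons, List.map_nil, List.sum_cons, List.sum_nil,
    comp_permOf_inv, Matrix.cons_val]
  ring

theorem symSum_alt34 : symSum alt34 F ![o, a, b, c, d, e, f]
    = F ![o, a, b, c, d, e, f] + F ![o, a, b, d, c, e, f] := by
  simp only [symSum, alt34, List.map_cons, List.map_nil, List.sum_cons, List.sum_nil,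
    comp_permOf_inv, Matrix.cons_val]
  ring

theorem symSum_alt45 : symSum alt45 F ![o, a, b, c, d, e, f]
    = F ![o, a, b, c, d, e, f] + F ![o, a, b, c, e, d, f] := by
  simp only [symSum, alt45, List.map_cons, List.map_nil, List.sum_cons, List.sum_nil,
    comp_permOf_inv, Matrix.cons_val]
  ring

theorem symSum_alt56 : symSum alt56 F ![o, a, b, c, d, e, f]
    = F ![o, a, b, c, d, e, f] + F ![o, a, b, c, d, f, e] := by
  simp only [symSum, alt56, List.map_cons, List.map_nil, List.sum_cons, List.sum_nil,
    comp_permOf_inv, Matrix.cons_val]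
  ring

theorem symSum_alt123 : symSum alt123 F ![o, a, b, c, d, e, f]
    = F ![o, a, b, c, d, e, f] + F ![o, a, c, b, d, e, f]
      + F ![o, b, a, c, d, e, f] + F ![o, b, c, a, d, e, f]
      + F ![o, c, a, b, d, e, f] + F ![o, c, b, a, d, e, f] := by
  simp only [symSum, alt123, List.map_cons, List.map_nil, List.sum_cons, List.sum_nil,
    comp_permOf_inv, Matrix.cons_val]
  ring

theorem symSum_alt345 : symSum alt345 F ![o, a, b, c, d, e, f]
    = F ![o, a, b, c, d, e, f] + F ![o, a, b, c, e, d, f]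
      + F ![o, a, b, d, c, e, f] + F ![o, a, b, d, e, c, f]
      + F ![o, a, b, e, c, d, f] + F ![o, a, b, e, d, c, f] := by
  simp only [symSum, alt345, List.map_cons, List.map_nil, List.sum_cons, List.sum_nil,
    comp_permOf_inv, Matrix.cons_val]
  ring

theorem symSum_alt456 : symSum alt456 F ![o, a, b, c, d, e, f]
    = F ![o, a, b, c, d, e, f] + F ![o, a, b, c, d, f, e]
      + F ![o, a, b, c, e, d, f] + F ![o, a, b, c, e, f, d]
      + F ![o, a, b, c, f, d, e] + F ![o, a, b, c, f, e, d] := by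
  simp only [symSum, alt456, List.map_cons, List.map_nil, List.sum_cons, List.sum_nil,
    comp_permOf_inv, Matrix.cons_val]
  ring

theorem symSum_altBlocks : symSum altBlocks F ![o, a, b, c, d, e, f]
    = F ![o, a, b, c, d, e, f] + F ![o, d, e, f, a, b, c] := by
  simp only [symSum, altBlocks, List.map_cons, List.map_nil, List.sum_cons, List.sum_nil,
    comp_permOf_inv, Matrix.cons_val]
  ring

theorem symSum_one (w : Fin 7 → Fin 7) : symSum [1] F w = F w := by
  simp only [symSum, List.map_cons, List.map_nil, List.sum_cons, List.sum_nil, add_zero, inv_one,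
    Equiv.Perm.coe_one, Function.comp_id]

end SymSum

/-- A family of functions of words, one for each association type, which is invariant under the
symmetries of the types. -/
structure IsSymmetric (Y : Fin 5 → (Fin 7 → Fin 7) → ℚ) : Prop where
  zero_swap12 : ∀ o a b c d e f, Y 0 ![o, a, b, c, d, e, f] = Y 0 ![o, b, a, c, d, e, f]
  zero_swap34 : ∀ o a b c d e f, Y 0 ![o, a, b, c, d, e, f] = Y 0 ![o, a, b, d, c, e, f]
  zero_swap56 : ∀ o a b c d e f, Y 0 ![o, a, b, c, d, e, f] = Y 0 ![o, a, b, c, d, f, e]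
  one_swap12 : ∀ o a b c d e f, Y 1 ![o, a, b, c, d, e, f] = Y 1 ![o, b, a, c, d, e, f]
  one_swap23 : ∀ o a b c d e f, Y 1 ![o, a, b, c, d, e, f] = Y 1 ![o, a, c, b, d, e, f]
  one_swap56 : ∀ o a b c d e f, Y 1 ![o, a, b, c, d, e, f] = Y 1 ![o, a, b, c, d, f, e]
  two_swap12 : ∀ o a b c d e f, Y 2 ![o, a, b, c, d, e, f] = Y 2 ![o, b, a, c, d, e, f]
  two_swap34 : ∀ o a b c d e f, Y 2 ![o, a, b, c, d, e, f] = Y 2 ![o, a, b, d, c, e, f]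
  two_swap45 : ∀ o a b c d e f, Y 2 ![o, a, b, c, d, e, f] = Y 2 ![o, a, b, c, e, d, f]
  three_swap12 : ∀ o a b c d e f, Y 3 ![o, a, b, c, d, e, f] = Y 3 ![o, b, a, c, d, e, f]
  three_swap23 : ∀ o a b c d e f, Y 3 ![o, a, b, c, d, e, f] = Y 3 ![o, a, c, b, d, e, f]
  three_swap45 : ∀ o a b c d e f, Y 3 ![o, a, b, c, d, e, f] = Y 3 ![o, a, b, c, e, d, f]
  four_swap12 : ∀ o a b c d e f, Y 4 ![o, a, b, c, d, e, f] = Y 4 ![o, b, a, c, d, e, f]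
  four_swap23 : ∀ o a b c d e f, Y 4 ![o, a, b, c, d, e, f] = Y 4 ![o, a, c, b, d, e, f]
  four_swap45 : ∀ o a b c d e f, Y 4 ![o, a, b, c, d, e, f] = Y 4 ![o, a, b, c, e, d, f]
  four_swap56 : ∀ o a b c d e f, Y 4 ![o, a, b, c, d, e, f] = Y 4 ![o, a, b, c, d, f, e]
  four_block : ∀ o a b c d e f, Y 4 ![o, a, b, c, d, e, f] = Y 4 ![o, d, e, f, a, b, c]

theorem isSymmetric_symmetrize (G : Fin 5 → (Fin 7 → Fin 7) → ℚ) :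
    IsSymmetric (symmetrize G) := by
  constructor <;> intro o a b c d e f <;>
  simp only [symmetrize, symmetries₁, symmetries₂, symmetries₃, symSum_alt12, symSum_alt34,
    symSum_alt45, symSum_alt56, symSum_alt123, symSum_alt345, symSum_alt456, symSum_altBlocks,
    symSum_one] <;>
  ring

/-- The functions of the letters other than the centre, obtained from coefficients for which all
words have coefficient zero. -/
def WordSystem.ofWordCoef (G : Fin 5 → (Fin 7 → Fin 7) → ℚ)
    (hG : ∀ k w, wordCoef G k w = 0) (o : Fin 7) : WordSystem (Fin 7) where
  y0 a b c d e f := symmetrize G 0 ![o, a, b, c, d, e, f]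
  y1 a b c d e f := symmetrize G 1 ![o, a, b, c, d, e, f]
  y2 a b c d e f := symmetrize G 2 ![o, a, b, c, d, e, f]
  y3 a b c d e f := symmetrize G 3 ![o, a, b, c, d, e, f]
  y4 a b c d e f := symmetrize G 4 ![o, a, b, c, d, e, f]
  y0_swap01 := (isSymmetric_symmetrize G).zero_swap12 o
  y0_swap23 := (isSymmetric_symmetrize G).zero_swap34 o
  y0_swap45 := (isSymmetric_symmetrize G).zero_swap56 o
  y1_swap01 := (isSymmetric_symmetrize G).one_swap12 o
  y1_swap12 := (isSymmetric_symmetrize G).one_swap23 o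
  y1_swap45 := (isSymmetric_symmetrize G).one_swap56 o
  y2_swap01 := (isSymmetric_symmetrize G).two_swap12 o
  y2_swap23 := (isSymmetric_symmetrize G).two_swap34 o
  y2_swap34 := (isSymmetric_symmetrize G).two_swap45 o
  y3_swap01 := (isSymmetric_symmetrize G).three_swap12 o
  y3_swap12 := (isSymmetric_symmetrize G).three_swap23 o
  y3_swap34 := (isSymmetric_symmetrize G).three_swap45 o
  y4_swap01 := (isSymmetric_symmetrize G).four_swap12 o
  y4_swap12 := (isSymmetric_symmetrize G).four_swap23 o
  y4_block := (isSymmetric_symmetrize G).four_block o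
  eq0 a b c d e f := by
    have h := hG 0 ![o, a, b, c, d, e, f]
    simp only [wordCoef, Fin.sum_univ_five, symSum, arrangements, List.map_cons, List.map_nil,
      List.sum_cons, List.sum_nil, comp_permOf_inv, Matrix.cons_val] at h
    linear_combination h
  eq1 a b c d e f := by
    have h := hG 1 ![o, a, b, c, d, e, f]
    simp only [wordCoef, Fin.sum_univ_five, symSum, arrangements, List.map_cons, List.map_nil,
      List.sum_cons, List.sum_nil, comp_permOf_inv, Matrix.cons_val] at h
    linear_combination h
  eq2 a b c d e f := by
    have hY := isSymmetric_symmetrize G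
    have h := hG 2 ![o, a, b, c, d, e, f]
    simp only [wordCoef, Fin.sum_univ_five, symSum, arrangements, List.map_cons, List.map_nil,
      List.sum_cons, List.sum_nil, comp_permOf_inv, Matrix.cons_val] at h
    linear_combination h + hY.zero_swap56 o c d e f a b + hY.zero_swap34 o c d a b e f +
      hY.zero_swap12 o a b c d e f + hY.two_swap12 o a b c d e f + hY.two_swap12 o a b d e f c +
      hY.one_swap56 o c d e f a b + hY.one_swap56 o d e f c a b
  eq3 a b c d e f := by
    have hY := isSymmetric_symmetrize G
    have h := hG 3 ![o, a, b, c, d, e, f]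
    simp only [wordCoef, Fin.sum_univ_five, symSum, arrangements, List.map_cons, List.map_nil,
      List.sum_cons, List.sum_nil, comp_permOf_inv, Matrix.cons_val] at h
    linear_combination h + hY.zero_swap34 o d e a b c f + hY.zero_swap56 o d e a f b c +
      hY.zero_swap12 o a b d e c f + hY.zero_swap12 o a b c d e f + hY.zero_swap56 o a d e f b c
      + hY.zero_swap34 o a d b c e f + hY.two_swap34 o d e a b c f + hY.two_swap45 o d e b a c f
      + hY.two_swap34 o d e b c a f + hY.two_swap12 o a b d e f c + hY.one_swap56 o d e f a b c
      + hY.one_swap12 o a b c d e f + hY.one_swap23 o b a c d e f + hY.one_swap12 o b c a d e f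
      + hY.four_swap12 o a b c d e f + hY.four_swap23 o b a c d e f + hY.four_swap12 o b c a d e
      f

/-- The dialgebra on `A × A` obtained by viewing `A × A` as the bimodule `A` over the algebra `A`
together with the first projection. -/
def pairDialgebra (A : Type*) [Ring A] [Algebra ℚ A] : Dialgebra ℚ (A × A) where
  l := LinearMap.mk₂ ℚ (fun m n => (m.1 * n.1, m.2 * n.1)) (by simp [add_mul]) (by simp)
    (by simp [mul_add]) (by simp)
  r := LinearMap.mk₂ ℚ (fun m n => (m.1 * n.1, m.1 * n.2)) (by simp [add_mul]) (by simp)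
    (by simp [mul_add]) (by simp)
  l_assoc := by simp [mul_assoc]
  r_assoc := by simp [mul_assoc]
  inner_assoc := by simp [mul_assoc]
  bar_right := by simp
  bar_left := by simp

/-- The letters `w`, arranged from left to right around the marked centre `w 0`. -/
def readingWord (k : Fin 7) (w : Fin 7 → Fin 7) : List (Fin 7 × Bool) :=
  match k with
  | 0 => [(w 0, true), (w 1, false), (w 2, false), (w 3, false), (w 4, false), (w 5, false),
      (w 6, false)]
  | 1 => [(w 1, false), (w 0, true), (w 2, false), (w 3, false), (w 4, false), (w 5, false),
      (w 6, false)]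
  | 2 => [(w 2, false), (w 1, false), (w 0, true), (w 3, false), (w 4, false), (w 5, false),
      (w 6, false)]
  | 3 => [(w 3, false), (w 2, false), (w 1, false), (w 0, true), (w 4, false), (w 5, false),
      (w 6, false)]
  | 4 => [(w 4, false), (w 3, false), (w 2, false), (w 1, false), (w 0, true), (w 5, false),
      (w 6, false)]
  | 5 => [(w 5, false), (w 4, false), (w 3, false), (w 2, false), (w 1, false), (w 0, true),
      (w 6, false)]
  | 6 => [(w 6, false), (w 5, false), (w 4, false), (w 3, false), (w 2, false), (w 1, false),
      (w 0, true)]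

theorem readingWord_injective {k k' : Fin 7} {w w' : Fin 7 → Fin 7}
    (h : readingWord k w = readingWord k' w') : k = k' ∧ w = w' := by
  have hk : k = k' := by
    have h' := congrArg (List.map Prod.snd) h
    revert h'
    fin_cases k <;> fin_cases k' <;> simp [readingWord]
  refine ⟨hk, ?_⟩
  subst hk
  suffices hw : w 0 = w' 0 ∧ w 1 = w' 1 ∧ w 2 = w' 2 ∧ w 3 = w' 3 ∧ w 4 = w' 4 ∧ w 5 = w' 5
      ∧ w 6 = w' 6 by
    obtain ⟨h0, h1, h2, h3, h4, h5, h6⟩ := hw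
    funext i
    fin_cases i <;> assumption
  fin_cases k <;> simp only [readingWord, List.cons.injEq, Prod.mk.injEq] at h <;> tauto

/-- The generic letters: unmarked in the first component, marked in the second. -/
noncomputable def genericLetter (i : Fin 7) :
    MonoidAlgebra ℚ (FreeMonoid (Fin 7 × Bool)) × MonoidAlgebra ℚ (FreeMonoid (Fin 7 × Bool)) :=
  (MonoidAlgebra.single (FreeMonoid.of (i, false)) 1,
    MonoidAlgebra.single (FreeMonoid.of (i, true)) 1)

theorem word_genericLetter_snd (k : Fin 7) (w : Fin 7 → Fin 7) :
    ((pairDialgebra _).word k (genericLetter ∘ w)).2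
      = MonoidAlgebra.single (FreeMonoid.ofList (readingWord k w)) 1 := by
  fin_cases k <;>
  simp only [Dialgebra.word, pairDialgebra, LinearMap.mk₂_apply, genericLetter, Function.comp_apply,
    MonoidAlgebra.single_mul_single, mul_one] <;>
  rfl

theorem wordCoef_eq_zero_of_forall (x : Mon7 → ℚ)
    (hx : ∀ (D : Type) [AddCommGroup D] [Module ℚ D] (A : Dialgebra ℚ D) (v : Fin 7 → D),
      ∑ m : Mon7, x m • evalMon7 A v m = 0) (k : Fin 7) (π : Equiv.Perm (Fin 7)) :
    wordCoef (signedCoef x) k π = 0 := by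
  have h := hx _ (pairDialgebra (MonoidAlgebra ℚ (FreeMonoid (Fin 7 × Bool)))) genericLetter
  rw [sum_smul_evalMon7] at h
  have h' := congrArg (fun p => MonoidAlgebra.coeff (Prod.snd p)
    (FreeMonoid.ofList (readingWord k π))) h
  simp only [Prod.snd_sum, Prod.smul_snd, word_genericLetter_snd, MonoidAlgebra.coeff_sum,
    MonoidAlgebra.coeff_smul, MonoidAlgebra.coeff_single, Finsupp.coe_finsetSum, Finsupp.coe_smul,
    Finset.sum_apply, Pi.smul_apply, Prod.snd_zero, MonoidAlgebra.coeff_zero, Finsupp.coe_zero,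
    Pi.zero_apply] at h'
  rw [Finset.sum_eq_single k, Finset.sum_eq_single π] at h'
  · have hk : leftSign k ≠ 0 := by fin_cases k <;> simp [leftSign]
    simpa [hk, sgn_ne_zero] using h'
  · intro π' _ hπ
    rw [Finsupp.single_eq_of_ne, smul_zero]
    exact fun e => hπ (DFunLike.coe_injective (readingWord_injective e).2).symm
  · simp
  · intro k' _ hk
    rw [Finset.sum_eq_zero, smul_zero]
    intro π' _
    rw [Finsupp.single_eq_of_ne, smul_zero]
    exact fun e => hk (readingWord_injective e).1.symm
  · simp

theorem eq_vec {α : Type*} (w : Fin 7 → α) : w = ![w 0, w 1, w 2, w 3, w 4, w 5, w 6] := by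
  funext i
  fin_cases i <;> rfl

section SortedSupport

variable (x : Mon7 → ℚ) (o a b c d e f : Fin 7)

theorem signedCoef_zero_eq_zero (h : ¬ (a < b ∧ c < d ∧ e < f)) :
    signedCoef x 0 ![o, a, b, c, d, e, f] = 0 :=
  signedCoef_eq_zero x _ _ fun m ht hm => h (by simpa [hm] using m.2.1 ht)

theorem signedCoef_one_eq_zero (h : ¬ (a < b ∧ b < c ∧ e < f)) :
    signedCoef x 1 ![o, a, b, c, d, e, f] = 0 :=
  signedCoef_eq_zero x _ _ fun m ht hm => h (by simpa [hm] using m.2.2.1 ht)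

theorem signedCoef_two_eq_zero (h : ¬ (a < b ∧ c < d ∧ d < e)) :
    signedCoef x 2 ![o, a, b, c, d, e, f] = 0 :=
  signedCoef_eq_zero x _ _ fun m ht hm => h (by simpa [hm] using m.2.2.2.1 ht)

theorem signedCoef_three_eq_zero (h : ¬ (a < b ∧ b < c ∧ d < e)) :
    signedCoef x 3 ![o, a, b, c, d, e, f] = 0 :=
  signedCoef_eq_zero x _ _ fun m ht hm => h (by simpa [hm] using m.2.2.2.2.1 ht)

theorem signedCoef_four_eq_zero (h : ¬ (a < b ∧ b < c ∧ d < e ∧ e < f ∧ a < d)) :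
    signedCoef x 4 ![o, a, b, c, d, e, f] = 0 :=
  signedCoef_eq_zero x _ _ fun m ht hm => h (by simpa [hm] using m.2.2.2.2.2 ht)

theorem symmetrize_signedCoef_zero (h12 : a < b) (h34 : c < d) (h56 : e < f) :
    symmetrize (signedCoef x) 0 ![o, a, b, c, d, e, f]
      = signedCoef x 0 ![o, a, b, c, d, e, f] := by
  simp only [symmetrize, symmetries₁, symmetries₂, symmetries₃, symSum_alt12, symSum_alt34,
    symSum_alt56, signedCoef_zero_eq_zero, h12.not_gt, h34.not_gt, h56.not_gt, false_and, and_false,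
    not_false_eq_true, add_zero]

theorem symmetrize_signedCoef_one (h12 : a < b) (h23 : b < c) (h56 : e < f) :
    symmetrize (signedCoef x) 1 ![o, a, b, c, d, e, f]
      = signedCoef x 1 ![o, a, b, c, d, e, f] := by
  simp only [symmetrize, symmetries₁, symmetries₂, symmetries₃, symSum_alt123, symSum_alt56,
    symSum_one, signedCoef_one_eq_zero, h12.not_gt, h23.not_gt, h56.not_gt, (h12.trans h23).not_gt,
    false_and, and_false, not_false_eq_true, add_zero]

theorem symmetrize_signedCoef_two (h12 : a < b) (h34 : c < d) (h45 : d < e) :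
    symmetrize (signedCoef x) 2 ![o, a, b, c, d, e, f]
      = signedCoef x 2 ![o, a, b, c, d, e, f] := by
  simp only [symmetrize, symmetries₁, symmetries₂, symmetries₃, symSum_alt12, symSum_alt345,
    symSum_one, signedCoef_two_eq_zero, h12.not_gt, h34.not_gt, h45.not_gt, (h34.trans h45).not_gt,
    false_and, and_false, not_false_eq_true, add_zero]

theorem symmetrize_signedCoef_three (h12 : a < b) (h23 : b < c) (h45 : d < e) :
    symmetrize (signedCoef x) 3 ![o, a, b, c, d, e, f]
      = signedCoef x 3 ![o, a, b, c, d, e, f] := by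
  simp only [symmetrize, symmetries₁, symmetries₂, symmetries₃, symSum_alt123, symSum_alt45,
    symSum_one, signedCoef_three_eq_zero, h12.not_gt, h23.not_gt, h45.not_gt,
    (h12.trans h23).not_gt, false_and, and_false, not_false_eq_true, add_zero]

theorem symmetrize_signedCoef_four (h12 : a < b) (h23 : b < c) (h45 : d < e) (h56 : e < f)
    (h14 : a < d) :
    symmetrize (signedCoef x) 4 ![o, a, b, c, d, e, f]
      = signedCoef x 4 ![o, a, b, c, d, e, f] := by
  simp only [symmetrize, symmetries₁, symmetries₂, symmetries₃, symSum_altBlocks, symSum_alt123,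
    symSum_alt456, signedCoef_four_eq_zero, h12.not_gt, h23.not_gt, h45.not_gt, h56.not_gt,
    h14.not_gt, (h12.trans h23).not_gt, (h45.trans h56).not_gt, false_and, and_false,
    not_false_eq_true, add_zero]

end SortedSupport

theorem symmetrize_signedCoef (x : Mon7 → ℚ) (m : Mon7) :
    symmetrize (signedCoef x) m.1.1 m.1.2 = signedCoef x m.1.1 m.1.2 := by
  obtain ⟨⟨t, π⟩, h0, h1, h2, h3, h4⟩ := m
  dsimp only at h0 h1 h2 h3 h4 ⊢
  rw [eq_vec π]
  match t with
  | 0 =>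
    obtain ⟨h12, h34, h56⟩ := h0 rfl
    exact symmetrize_signedCoef_zero x _ _ _ _ _ _ _ h12 h34 h56
  | 1 =>
    obtain ⟨h12, h23, h56⟩ := h1 rfl
    exact symmetrize_signedCoef_one x _ _ _ _ _ _ _ h12 h23 h56
  | 2 =>
    obtain ⟨h12, h34, h45⟩ := h2 rfl
    exact symmetrize_signedCoef_two x _ _ _ _ _ _ _ h12 h34 h45
  | 3 =>
    obtain ⟨h12, h23, h45⟩ := h3 rfl
    exact symmetrize_signedCoef_three x _ _ _ _ _ _ _ h12 h23 h45
  | 4 =>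
    obtain ⟨h12, h23, h45, h56, h14⟩ := h4 rfl
    exact symmetrize_signedCoef_four x _ _ _ _ _ _ _ h12 h23 h45 h56 h14

theorem forall_of_le {P : Fin 7 → Fin 7 → Prop} (hs : ∀ a b, P a b → P b a)
    (h : ∀ a b, a ≤ b → P a b) (a b : Fin 7) : P a b :=
  (le_total a b).elim (h a b) fun hba => hs _ _ (h _ _ hba)

theorem forall_of_le_of_le {P : Fin 7 → Fin 7 → Fin 7 → Prop}
    (h₁₂ : ∀ a b c, P a b c → P b a c) (h₂₃ : ∀ a b c, P a b c → P a c b)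
    (h : ∀ a b c, a ≤ b → b ≤ c → P a b c) (a b c : Fin 7) : P a b c := by
  rcases le_total a b with hab | hab
  · rcases le_total b c with hbc | hbc
    · exact h _ _ _ hab hbc
    · rcases le_total a c with hac | hac
      · exact h₂₃ _ _ _ (h _ _ _ hac hbc)
      · exact h₂₃ _ _ _ (h₁₂ _ _ _ (h _ _ _ hac hab))
  · rcases le_total a c with hac | hac
    · exact h₁₂ _ _ _ (h _ _ _ hab hac)
    · rcases le_total b c with hbc | hbc
      · exact h₁₂ _ _ _ (h₂₃ _ _ _ (h _ _ _ hbc hac))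
      · exact h₁₂ _ _ _ (h₂₃ _ _ _ (h₁₂ _ _ _ (h _ _ _ hbc hab)))

namespace IsSymmetric

variable {Y Y' : Fin 5 → (Fin 7 → Fin 7) → ℚ}

theorem eq_of_eq_on_mon7 (hY : IsSymmetric Y) (hY' : IsSymmetric Y')
    (h : ∀ m : Mon7, Y m.1.1 m.1.2 = Y' m.1.1 m.1.2) (t : Fin 5) (π : Equiv.Perm (Fin 7)) :
    Y t π = Y' t π := by
  have key (t : Fin 5) (o a b c d e f : Fin 7) (hn : [o, a, b, c, d, e, f].Nodup)
      (h0 : t = 0 → a ≤ b ∧ c ≤ d ∧ e ≤ f) (h1 : t = 1 → a ≤ b ∧ b ≤ c ∧ e ≤ f)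
      (h2 : t = 2 → a ≤ b ∧ c ≤ d ∧ d ≤ e) (h3 : t = 3 → a ≤ b ∧ b ≤ c ∧ d ≤ e)
      (h4 : t = 4 → a ≤ b ∧ b ≤ c ∧ d ≤ e ∧ e ≤ f ∧ a ≤ d) :
      Y t ![o, a, b, c, d, e, f] = Y' t ![o, a, b, c, d, e, f] := by
    have hi : Function.Injective ![o, a, b, c, d, e, f] := by
      rw [← List.nodup_ofFn]
      simpa [List.ofFn_succ] using hn
    have hlt {i j : Fin 7} (hij : i ≠ j)
        (hle : ![o, a, b, c, d, e, f] i ≤ ![o, a, b, c, d, e, f] j) :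
        ![o, a, b, c, d, e, f] i < ![o, a, b, c, d, e, f] j :=
      lt_of_le_of_ne hle (hi.ne hij)
    refine h ⟨(t, Equiv.ofBijective _ (Finite.injective_iff_bijective.1 hi)), ?_, ?_, ?_, ?_, ?_⟩
    · exact fun ht => ⟨hlt (i := 1) (j := 2) (by decide) (h0 ht).1,
        hlt (i := 3) (j := 4) (by decide) (h0 ht).2.1,
        hlt (i := 5) (j := 6) (by decide) (h0 ht).2.2⟩
    · exact fun ht => ⟨hlt (i := 1) (j := 2) (by decide) (h1 ht).1,
        hlt (i := 2) (j := 3) (by decide) (h1 ht).2.1,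
        hlt (i := 5) (j := 6) (by decide) (h1 ht).2.2⟩
    · exact fun ht => ⟨hlt (i := 1) (j := 2) (by decide) (h2 ht).1,
        hlt (i := 3) (j := 4) (by decide) (h2 ht).2.1,
        hlt (i := 4) (j := 5) (by decide) (h2 ht).2.2⟩
    · exact fun ht => ⟨hlt (i := 1) (j := 2) (by decide) (h3 ht).1,
        hlt (i := 2) (j := 3) (by decide) (h3 ht).2.1,
        hlt (i := 4) (j := 5) (by decide) (h3 ht).2.2⟩
    · exact fun ht => ⟨hlt (i := 1) (j := 2) (by decide) (h4 ht).1,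
        hlt (i := 2) (j := 3) (by decide) (h4 ht).2.1,
        hlt (i := 4) (j := 5) (by decide) (h4 ht).2.2.1,
        hlt (i := 5) (j := 6) (by decide) (h4 ht).2.2.2.1,
        hlt (i := 1) (j := 4) (by decide) (h4 ht).2.2.2.2⟩
  suffices hs : ∀ o a b c d e f : Fin 7, [o, a, b, c, d, e, f].Nodup →
      Y t ![o, a, b, c, d, e, f] = Y' t ![o, a, b, c, d, e, f] by
    rw [eq_vec π]
    exact hs _ _ _ _ _ _ _ (by simp)
  have h12 {o a b c d e f : Fin 7} (hn : [o, a, b, c, d, e, f].Nodup) :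
      [o, b, a, c, d, e, f].Nodup :=
    hn.perm ((List.Perm.swap _ _ _).cons _)
  have h23 {o a b c d e f : Fin 7} (hn : [o, a, b, c, d, e, f].Nodup) :
      [o, a, c, b, d, e, f].Nodup :=
    hn.perm (((List.Perm.swap _ _ _).cons _).cons _)
  have h34 {o a b c d e f : Fin 7} (hn : [o, a, b, c, d, e, f].Nodup) :
      [o, a, b, d, c, e, f].Nodup :=
    hn.perm ((((List.Perm.swap _ _ _).cons _).cons _).cons _)
  have h45 {o a b c d e f : Fin 7} (hn : [o, a, b, c, d, e, f].Nodup) :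
      [o, a, b, c, e, d, f].Nodup :=
    hn.perm (((((List.Perm.swap _ _ _).cons _).cons _).cons _).cons _)
  have h56 {o a b c d e f : Fin 7} (hn : [o, a, b, c, d, e, f].Nodup) :
      [o, a, b, c, d, f, e].Nodup :=
    hn.perm ((((((List.Perm.swap _ _ _).cons _).cons _).cons _).cons _).cons _)
  intro o a b c d e f
  match t with
  | 0 =>
    revert e f
    refine forall_of_le (fun _ _ H hn => (hY.zero_swap56 ..).trans ((H (h56 hn)).trans
        (hY'.zero_swap56 ..).symm)) ?_
    intro e f hef
    revert c d
    refine forall_of_le (fun _ _ H hn => (hY.zero_swap34 ..).trans ((H (h34 hn)).trans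
        (hY'.zero_swap34 ..).symm)) ?_
    intro c d hcd
    revert a b
    refine forall_of_le (fun _ _ H hn => (hY.zero_swap12 ..).trans ((H (h12 hn)).trans
        (hY'.zero_swap12 ..).symm)) ?_
    intro a b hab
    refine fun hn => key _ _ _ _ _ _ _ _ hn ?_ ?_ ?_ ?_ ?_ <;> intro ht <;>
      first | exact ⟨hab, hcd, hef⟩ | exact absurd ht (by decide)
  | 1 =>
    revert e f
    refine forall_of_le (fun _ _ H hn => (hY.one_swap56 ..).trans ((H (h56 hn)).trans
        (hY'.one_swap56 ..).symm)) ?_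
    intro e f hef
    revert a b c
    refine forall_of_le_of_le (fun _ _ _ H hn => (hY.one_swap12 ..).trans ((H (h12 hn)).trans
        (hY'.one_swap12 ..).symm))
      (fun _ _ _ H hn => (hY.one_swap23 ..).trans ((H (h23 hn)).trans
        (hY'.one_swap23 ..).symm)) ?_
    intro a b c hab hbc
    refine fun hn => key _ _ _ _ _ _ _ _ hn ?_ ?_ ?_ ?_ ?_ <;> intro ht <;>
      first | exact ⟨hab, hbc, hef⟩ | exact absurd ht (by decide)
  | 2 =>
    revert c d e
    refine forall_of_le_of_le (fun _ _ _ H hn => (hY.two_swap34 ..).trans ((H (h34 hn)).trans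
        (hY'.two_swap34 ..).symm))
      (fun _ _ _ H hn => (hY.two_swap45 ..).trans ((H (h45 hn)).trans
        (hY'.two_swap45 ..).symm)) ?_
    intro c d e hcd hde
    revert a b
    refine forall_of_le (fun _ _ H hn => (hY.two_swap12 ..).trans ((H (h12 hn)).trans
        (hY'.two_swap12 ..).symm)) ?_
    intro a b hab
    refine fun hn => key _ _ _ _ _ _ _ _ hn ?_ ?_ ?_ ?_ ?_ <;> intro ht <;>
      first | exact ⟨hab, hcd, hde⟩ | exact absurd ht (by decide)
  | 3 =>
    revert d e
    refine forall_of_le (fun _ _ H hn => (hY.three_swap45 ..).trans ((H (h45 hn)).trans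
        (hY'.three_swap45 ..).symm)) ?_
    intro d e hde
    revert a b c
    refine forall_of_le_of_le (fun _ _ _ H hn => (hY.three_swap12 ..).trans ((H (h12 hn)).trans
        (hY'.three_swap12 ..).symm))
      (fun _ _ _ H hn => (hY.three_swap23 ..).trans ((H (h23 hn)).trans
        (hY'.three_swap23 ..).symm)) ?_
    intro a b c hab hbc
    refine fun hn => key _ _ _ _ _ _ _ _ hn ?_ ?_ ?_ ?_ ?_ <;> intro ht <;>
      first | exact ⟨hab, hbc, hde⟩ | exact absurd ht (by decide)
  | 4 =>
    revert d e f
    refine forall_of_le_of_le (fun _ _ _ H hn => (hY.four_swap45 ..).trans ((H (h45 hn)).trans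
        (hY'.four_swap45 ..).symm))
      (fun _ _ _ H hn => (hY.four_swap56 ..).trans ((H (h56 hn)).trans
        (hY'.four_swap56 ..).symm)) ?_
    intro d e f hde hef
    revert a b c
    refine forall_of_le_of_le (fun _ _ _ H hn => (hY.four_swap12 ..).trans ((H (h12 hn)).trans
        (hY'.four_swap12 ..).symm))
      (fun _ _ _ H hn => (hY.four_swap23 ..).trans ((H (h23 hn)).trans
        (hY'.four_swap23 ..).symm)) ?_
    intro a b c hab hbc hn
    rcases le_total a d with had | hda
    · refine key _ _ _ _ _ _ _ _ hn ?_ ?_ ?_ ?_ ?_ <;> intro ht <;>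
        first | exact ⟨hab, hbc, hde, hef, had⟩ | exact absurd ht (by decide)
    · refine (hY.four_block ..).trans (Eq.trans ?_ (hY'.four_block ..).symm)
      have hn' : [o, d, e, f, a, b, c].Nodup :=
        hn.perm ((List.perm_append_comm (l₁ := [a, b, c]) (l₂ := [d, e, f])).cons o)
      refine key _ _ _ _ _ _ _ _ hn' ?_ ?_ ?_ ?_ ?_ <;> intro ht <;>
        first | exact ⟨hde, hef, hab, hbc, hda⟩ | exact absurd ht (by decide)

end IsSymmetric

/-- The common form of the symmetrized coefficients of the identities: `s o g` is the coefficient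
of the identity `S` and `r o` the coefficient of the identity `R`, where `o` is the first letter
of a monomial. -/
def identityFamily (s : Fin 7 → Fin 7 → ℚ) (r : Fin 7 → ℚ) (t : Fin 5) (w : Fin 7 → Fin 7) : ℚ :=
  match t with
  | 0 => s (w 0) (w 3) + s (w 0) (w 4)
  | 1 => r (w 0) - (s (w 0) (w 1) + s (w 0) (w 2) + s (w 0) (w 3) + s (w 0) (w 5) + s (w 0) (w 6))
  | 2 => s (w 0) (w 6) - r (w 0)
  | 3 => s (w 0) (w 4) + s (w 0) (w 5)
  | 4 => -(s (w 0) (w 1) + s (w 0) (w 2) + s (w 0) (w 3) + s (w 0) (w 4) + s (w 0) (w 5)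
      + s (w 0) (w 6))

theorem isSymmetric_identityFamily (s : Fin 7 → Fin 7 → ℚ) (r : Fin 7 → ℚ) :
    IsSymmetric (identityFamily s r) := by
  constructor <;> intro o a b c d e f <;> simp only [identityFamily, Matrix.cons_val] <;> ring

theorem sum_symSum_identityFamily (s : Fin 7 → Fin 7 → ℚ) (r : Fin 7 → ℚ) (k : Fin 7)
    (w : Fin 7 → Fin 7) : ∑ t, symSum (arrangements t k) (identityFamily s r t) w = 0 := by
  match k with
  | 0 | 1 | 2 | 3 | 4 | 5 | 6 =>
    simp only [Fin.sum_univ_five, symSum, arrangements, List.map_cons, List.map_nil, List.sum_cons,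
      List.sum_nil, comp_permOf_inv, identityFamily, Matrix.cons_val]
    ring

theorem identityFamily_add (s s' : Fin 7 → Fin 7 → ℚ) (r r' : Fin 7 → ℚ) (t : Fin 5)
    (w : Fin 7 → Fin 7) : identityFamily (s + s') (r + r') t w
      = identityFamily s r t w + identityFamily s' r' t w := by
  match t with
  | 0 | 1 | 2 | 3 | 4 =>
    simp only [identityFamily, Pi.add_apply]
    ring

theorem identityFamily_smul (c : ℚ) (s : Fin 7 → Fin 7 → ℚ) (r : Fin 7 → ℚ) (t : Fin 5)
    (w : Fin 7 → Fin 7) : identityFamily (c • s) (c • r) t w = c * identityFamily s r t w := by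
  match t with
  | 0 | 1 | 2 | 3 | 4 =>
    simp only [identityFamily, Pi.smul_apply, smul_eq_mul]
    ring

/-- The coefficient vector with symmetrized coefficients `identityFamily s r`. -/
def identityVector : ((Fin 7 → Fin 7 → ℚ) × (Fin 7 → ℚ)) →ₗ[ℚ] (Mon7 → ℚ) where
  toFun p m := sgn m.1.2 * identityFamily p.1 p.2 m.1.1 m.1.2
  map_add' p q := by
    funext m
    simp only [Prod.fst_add, Prod.snd_add, identityFamily_add, Pi.add_apply, mul_add]
  map_smul' c p := by
    funext m
    simp only [Prod.smul_fst, Prod.smul_snd, identityFamily_smul, Pi.smul_apply, smul_eq_mul,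
      RingHom.id_apply, mul_left_comm]

theorem identityVector_apply (s : Fin 7 → Fin 7 → ℚ) (r : Fin 7 → ℚ) (m : Mon7) :
    identityVector (s, r) m = sgn m.1.2 * identityFamily s r m.1.1 m.1.2 := rfl

theorem symmetrize_signedCoef_identityVector (s : Fin 7 → Fin 7 → ℚ) (r : Fin 7 → ℚ) (t : Fin 5)
    (π : Equiv.Perm (Fin 7)) :
    symmetrize (signedCoef (identityVector (s, r))) t π = identityFamily s r t π := by
  refine (isSymmetric_symmetrize _).eq_of_eq_on_mon7 (isSymmetric_identityFamily s r) ?_ t π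
  intro m
  rw [symmetrize_signedCoef, signedCoef_apply, identityVector_apply, ← mul_assoc, sgn_mul_self,
    one_mul]

theorem sum_smul_evalMon7_identityVector (s : Fin 7 → Fin 7 → ℚ) (r : Fin 7 → ℚ) {D : Type}
    [AddCommGroup D] [Module ℚ D] (A : Dialgebra ℚ D) (v : Fin 7 → D) :
    ∑ m : Mon7, identityVector (s, r) m • evalMon7 A v m = 0 := by
  have h (k : Fin 7) (π : Equiv.Perm (Fin 7)) :
      wordCoef (signedCoef (identityVector (s, r))) k π = 0 := by
    rw [← sum_symSum_identityFamily s r k π]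
    refine Finset.sum_congr rfl fun t _ => congrArg List.sum (List.map_congr_left fun h _ => ?_)
    exact symmetrize_signedCoef_identityVector s r t (π * h⁻¹)
  simp [sum_smul_evalMon7, h]

theorem comp_perm_eq_of_adjacent {n : ℕ} {α β : Type*} {g : (Fin (n + 1) → α) → β}
    (hg : ∀ w (i : Fin n), g (w ∘ Equiv.swap i.castSucc i.succ) = g w)
    (σ : Equiv.Perm (Fin (n + 1))) (w : Fin (n + 1) → α) : g (w ∘ σ) = g w := by
  have hσ : σ ∈ Submonoid.closure
      (Set.range fun i : Fin n => Equiv.swap i.castSucc i.succ) := by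
    rw [Equiv.Perm.mclosure_swap_castSucc_succ]
    trivial
  induction hσ using Submonoid.closure_induction_right with
  | one => rfl
  | mul_right σ _ τ hτ ih =>
    obtain ⟨i, rfl⟩ := hτ
    rw [Equiv.Perm.coe_mul, ← Function.comp_assoc, hg, ih]

theorem eq_of_range_eq_of_adjacent {n : ℕ} {α β : Type*} {g : (Fin (n + 1) → α) → β}
    (hg : ∀ w (i : Fin n), g (w ∘ Equiv.swap i.castSucc i.succ) = g w)
    {w w' : Fin (n + 1) → α} (hw : Function.Injective w) (hw' : Function.Injective w')
    (h : Set.range w = Set.range w') : g w = g w' := by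
  let σ := (Equiv.ofInjective w hw).trans
    ((Equiv.setCongr h).trans (Equiv.ofInjective w' hw').symm)
  have hσ : w' ∘ σ = w := by
    funext i
    exact congrArg Subtype.val (Equiv.apply_symm_apply (Equiv.ofInjective w' hw')
      (Equiv.setCongr h (Equiv.ofInjective w hw i)))
  rw [← hσ, comp_perm_eq_of_adjacent hg]

namespace WordSystem

theorem s_eq_of_perm (S : WordSystem (Fin 7)) {π π' : Equiv.Perm (Fin 7)} (h0 : π 0 = π' 0)
    (h1 : π 1 = π' 1) : S.s (π 1) (π 2) (π 3) (π 4) (π 5) (π 6)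
      = S.s (π' 1) (π' 2) (π' 3) (π' 4) (π' 5) (π' 6) := by
  have hr (π : Equiv.Perm (Fin 7)) :
      Set.range (π ∘ (Fin.natAdd 2 : Fin 5 → Fin 7)) = {π 0, π 1}ᶜ := by
    rw [Set.range_comp, ← Set.image_pair, ← Set.image_compl_eq π.bijective]
    congr 1
    ext i
    simp only [Set.mem_range, Set.mem_compl_iff, Set.mem_insert_iff, Set.mem_singleton_iff]
    revert i
    decide
  rw [h1]
  refine eq_of_range_eq_of_adjacent (g := fun w : Fin 5 → Fin 7 =>
    S.s (π' 1) (w 0) (w 1) (w 2) (w 3) (w 4)) ?_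
    (π.injective.comp (Fin.natAdd_injective 5 2)) (π'.injective.comp (Fin.natAdd_injective 5 2))
    (by rw [hr, hr, h0, h1])
  intro w i
  fin_cases i
  · exact (S.s_swap12 ..).symm
  · exact (S.s_swap23 ..).symm
  · exact (S.s_swap34 ..).symm
  · exact (S.s_swap45 ..).symm

theorem r_eq_of_perm (S : WordSystem (Fin 7)) {π π' : Equiv.Perm (Fin 7)} (h0 : π 0 = π' 0) :
    S.r (π 1) (π 2) (π 3) (π 4) (π 5) (π 6)
      = S.r (π' 1) (π' 2) (π' 3) (π' 4) (π' 5) (π' 6) := by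
  have hr (π : Equiv.Perm (Fin 7)) :
      Set.range (π ∘ (Fin.succ : Fin 6 → Fin 7)) = {π 0}ᶜ := by
    rw [Set.range_comp, Fin.range_succ, Set.image_compl_eq π.bijective, Set.image_singleton]
  refine eq_of_range_eq_of_adjacent (g := fun w : Fin 6 → Fin 7 =>
    S.r (w 0) (w 1) (w 2) (w 3) (w 4) (w 5)) ?_
    (π.injective.comp (Fin.succ_injective 6)) (π'.injective.comp (Fin.succ_injective 6))
    (by rw [hr, hr, h0])
  intro w i
  fin_cases i
  · exact (S.r_swap01 ..).symm
  · exact (S.r_swap12 ..).symm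
  · exact (S.r_swap23 ..).symm
  · exact (S.r_swap34 ..).symm
  · exact (S.r_swap45 ..).symm

theorem exists_eq_identityFamily (S : Fin 7 → WordSystem (Fin 7)) :
    ∃ (s : Fin 7 → Fin 7 → ℚ) (r : Fin 7 → ℚ), ∀ o a b c d e f : Fin 7,
      [o, a, b, c, d, e, f].Nodup →
        (S o).s a b c d e f = s o a ∧ (S o).r a b c d e f = r o := by
  let fs (π : Equiv.Perm (Fin 7)) := (S (π 0)).s (π 1) (π 2) (π 3) (π 4) (π 5) (π 6)
  let fr (π : Equiv.Perm (Fin 7)) := (S (π 0)).r (π 1) (π 2) (π 3) (π 4) (π 5) (π 6)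
  have hs : fs.FactorsThrough fun π => (π 0, π 1) := by
    intro π π' h
    rw [Prod.mk.injEq] at h
    dsimp only [fs]
    rw [h.1, (S (π' 0)).s_eq_of_perm h.1 h.2]
  have hr : fr.FactorsThrough fun π => π 0 := by
    intro π π' (h : π 0 = π' 0)
    dsimp only [fr]
    rw [h, (S (π' 0)).r_eq_of_perm h]
  refine ⟨fun o a => Function.extend (fun π : Equiv.Perm (Fin 7) => (π 0, π 1)) fs 0 (o, a),
    Function.extend (fun π : Equiv.Perm (Fin 7) => π 0) fr 0, fun o a b c d e f hn => ?_⟩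
  have hi : Function.Injective ![o, a, b, c, d, e, f] := by
    rw [← List.nodup_ofFn]
    simpa [List.ofFn_succ] using hn
  let π := Equiv.ofBijective _ (Finite.injective_iff_bijective.1 hi)
  exact ⟨(hs.extend_apply 0 π).symm, (hr.extend_apply 0 π).symm⟩

end WordSystem

theorem exists_eq_identityVector (x : Mon7 → ℚ)
    (hx : ∀ k (π : Equiv.Perm (Fin 7)), wordCoef (signedCoef x) k π = 0) :
    ∃ s r, x = identityVector (s, r) := by
  let S := WordSystem.ofWordCoef (signedCoef x) fun k w =>
    wordCoef_signedCoef_eq_zero x k (hx k) w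
  obtain ⟨s, r, hS⟩ := WordSystem.exists_eq_identityFamily S
  refine ⟨s, r, funext fun m => ?_⟩
  have key (t : Fin 5) (o a b c d e f : Fin 7) (hn : [o, a, b, c, d, e, f].Nodup) :
      symmetrize (signedCoef x) t ![o, a, b, c, d, e, f]
        = identityFamily s r t ![o, a, b, c, d, e, f] := by
    have ha := (hS _ _ _ _ _ _ _ hn).1
    have hr := (hS _ _ _ _ _ _ _ hn).2
    have hb := (hS _ _ _ _ _ _ _ (hn.perm
      ((List.perm_middle (l₁ := [a]) (l₂ := [c, d, e, f])).cons o))).1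
    have hc := (hS _ _ _ _ _ _ _ (hn.perm
      ((List.perm_middle (l₁ := [a, b]) (l₂ := [d, e, f])).cons o))).1
    have hd := (hS _ _ _ _ _ _ _ (hn.perm
      ((List.perm_middle (l₁ := [a, b, c]) (l₂ := [e, f])).cons o))).1
    have he := (hS _ _ _ _ _ _ _ (hn.perm
      ((List.perm_middle (l₁ := [a, b, c, d]) (l₂ := [f])).cons o))).1
    have hf := (hS _ _ _ _ _ _ _ (hn.perm
      ((List.perm_middle (l₁ := [a, b, c, d, e]) (l₂ := [])).cons o))).1
    match t with
    | 0 =>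
      refine ((S o).y0_eq a b c d e f).trans ?_
      rw [hc, hd]
      rfl
    | 1 =>
      refine ((S o).y1_eq_s_add_r a b c d e f).trans ?_
      rw [hr, ha, hb, hc, he, hf]
      rfl
    | 2 =>
      refine ((S o).y2_eq a b c d e f).trans ?_
      rw [hf, hr]
      rfl
    | 3 =>
      refine ((S o).y3_eq a b c d e f).trans ?_
      rw [hd, he]
      rfl
    | 4 =>
      refine ((S o).y4_eq a b c d e f).trans ?_
      rw [ha, hb, hc, hd, he, hf]
      rfl
  have h := symmetrize_signedCoef x m
  rw [eq_vec m.1.2, key _ _ _ _ _ _ _ _ (by simp), ← eq_vec m.1.2,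
    signedCoef_apply] at h
  rw [identityVector_apply, h, ← mul_assoc, sgn_mul_self, one_mul]

theorem vecR_eq (π : Equiv.Perm (Fin 7)) :
    vecR π = sgn π • identityVector (0, Pi.single (π 0) 1) := by
  have key (t : Fin 5) (τ : Equiv.Perm (Fin 7)) :
      (if t = 1 ∧ τ 0 = π 0 then sgn τ else if t = 2 ∧ τ 0 = π 0 then -sgn τ else 0)
        = sgn τ * identityFamily 0 (Pi.single (π 0) 1) t τ := by
    match t with
    | 0 | 1 | 2 | 3 | 4 =>
      by_cases h : τ 0 = π 0 <;> simp [identityFamily, h]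
  exact funext fun m => congrArg (sgn π * ·) (key m.1.1 m.1.2)

theorem vecS_eq (π : Equiv.Perm (Fin 7)) :
    vecS π = sgn π • identityVector (Pi.single (π 0) (Pi.single (π 6) 1), 0) := by
  have key (t : Fin 5) (τ : Equiv.Perm (Fin 7)) :
      (if t = 0 ∧ τ 0 = π 0 ∧ (τ 3 = π 6 ∨ τ 4 = π 6) then sgn τ
        else if t = 1 ∧ τ 0 = π 0 ∧ (τ 5 = π 6 ∨ τ 6 = π 6) then -sgn τ
        else if t = 1 ∧ τ 0 = π 0 ∧ (τ 1 = π 6 ∨ τ 2 = π 6 ∨ τ 3 = π 6) then -sgn τ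
        else if t = 2 ∧ τ 0 = π 0 ∧ τ 6 = π 6 then sgn τ
        else if t = 3 ∧ τ 0 = π 0 ∧ (τ 4 = π 6 ∨ τ 5 = π 6) then sgn τ
        else if t = 4 ∧ τ 0 = π 0 then -sgn τ
        else 0) = sgn τ * identityFamily (Pi.single (π 0) (Pi.single (π 6) 1)) 0 t τ := by
    by_cases h : τ 0 = π 0
    · obtain ⟨j, hj⟩ := τ.surjective (π 6)
      have h0 : j ≠ 0 := by
        rintro rfl
        exact absurd (π.injective (h.symm.trans hj)) (by decide)
      match t with
      | 0 | 1 | 2 | 3 | 4 =>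
        simp only [identityFamily, h, Pi.single_eq_same, ← hj, Pi.single_apply, τ.injective.eq_iff,
          Pi.zero_apply]
        match j with
        | 0 => exact absurd rfl h0
        | 1 | 2 | 3 | 4 | 5 | 6 => simp
    · match t with
      | 0 | 1 | 2 | 3 | 4 => simp [identityFamily, h]
  exact funext fun m => congrArg (sgn π * ·) (key m.1.1 m.1.2)

theorem exists_perm_apply_eq {α : Type*} [DecidableEq α] {i j o g : α} (hij : i ≠ j)
    (hog : o ≠ g) : ∃ π : Equiv.Perm α, π i = o ∧ π j = g := by
  have h : o ≠ Equiv.swap i o j := by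
    conv_lhs => rw [← Equiv.swap_apply_left i o]
    exact (Equiv.injective _).ne hij
  refine ⟨Equiv.swap (Equiv.swap i o j) g * Equiv.swap i o, ?_, ?_⟩
  · rw [Equiv.Perm.mul_apply, Equiv.swap_apply_left, Equiv.swap_apply_of_ne_of_ne h hog]
  · rw [Equiv.Perm.mul_apply, Equiv.swap_apply_left]

/-- Extension by zero on the diagonal. -/
def extendDiag {ι : Type*} [DecidableEq ι] :
    ({p : ι × ι // p.1 ≠ p.2} → ℚ) →ₗ[ℚ] (ι → ι → ℚ) where
  toFun f o g := if h : o ≠ g then f ⟨(o, g), h⟩ else 0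
  map_add' f f' := by
    funext o g
    by_cases h : o = g <;> simp [h]
  map_smul' c f := by
    funext o g
    by_cases h : o = g <;> simp [h]

theorem extendDiag_of_ne {ι : Type*} [DecidableEq ι] (f : {p : ι × ι // p.1 ≠ p.2} → ℚ)
    {o g : ι} (h : o ≠ g) : extendDiag f o g = f ⟨(o, g), h⟩ :=
  dif_pos h

theorem extendDiag_single {ι : Type*} [DecidableEq ι] (p : {p : ι × ι // p.1 ≠ p.2}) :
    extendDiag (Pi.single p 1) = Pi.single p.1.1 (Pi.single p.1.2 1) := by
  obtain ⟨⟨a, b⟩, hab⟩ := p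
  funext o g
  by_cases h : o = g
  · subst h
    have : extendDiag (Pi.single ⟨(a, b), hab⟩ 1) o o = (0 : ℚ) := dif_neg (by simp)
    rw [this]
    by_cases ha : o = a
    · subst ha
      simp [hab]
    · simp [ha]
  · rw [extendDiag_of_ne _ h]
    by_cases ha : o = a
    · subst ha
      simp [Pi.single_apply]
    · simp [ha]

/-- The coefficient vectors coming from the identity `R`. -/
def vectorR : (Fin 7 → ℚ) →ₗ[ℚ] (Mon7 → ℚ) :=
  identityVector ∘ₗ LinearMap.inr ℚ _ _

/-- The coefficient vectors coming from the identity `S`. -/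
def vectorS : ({p : Fin 7 × Fin 7 // p.1 ≠ p.2} → ℚ) →ₗ[ℚ] (Mon7 → ℚ) :=
  identityVector ∘ₗ LinearMap.inl ℚ _ _ ∘ₗ extendDiag

theorem vectorR_add_vectorS (r : Fin 7 → ℚ) (f : {p : Fin 7 × Fin 7 // p.1 ≠ p.2} → ℚ) :
    vectorR r + vectorS f = identityVector (extendDiag f, r) := by
  simp [vectorR, vectorS, ← map_add]

theorem identityVector_eq_vectorR_add_vectorS (s : Fin 7 → Fin 7 → ℚ) (r : Fin 7 → ℚ) :
    identityVector (s, r) = vectorR r + vectorS fun p => s p.1.1 p.1.2 := by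
  rw [vectorR_add_vectorS]
  funext m
  obtain ⟨t, τ, ht, hτ⟩ : ∃ t τ, t = m.1.1 ∧ τ = m.1.2 := ⟨_, _, rfl, rfl⟩
  have h (i : Fin 7) (hi : 0 ≠ i) :
      extendDiag (fun p => s p.1.1 p.1.2) (τ 0) (τ i) = s (τ 0) (τ i) :=
    extendDiag_of_ne _ (τ.injective.ne hi)
  rw [identityVector_apply, identityVector_apply, ← ht, ← hτ]
  clear ht hτ
  match t with
  | 0 | 1 | 2 | 3 | 4 =>
    simp only [identityFamily, h 1 (by decide), h 2 (by decide), h 3 (by decide), h 4 (by decide),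
      h 5 (by decide), h 6 (by decide)]

theorem eq_zero_of_identityVector_eq_zero {s : Fin 7 → Fin 7 → ℚ} {r : Fin 7 → ℚ}
    (h : identityVector (s, r) = 0) : (∀ o g, o ≠ g → s o g = 0) ∧ r = 0 := by
  have key (t : Fin 5) (π : Equiv.Perm (Fin 7)) : identityFamily s r t π = 0 := by
    have h0 (t : Fin 5) (w : Fin 7 → Fin 7) : identityFamily 0 0 t w = 0 := by
      simpa using identityFamily_smul 0 0 0 t w
    rw [← h0 t π]
    refine (isSymmetric_identityFamily s r).eq_of_eq_on_mon7 (isSymmetric_identityFamily 0 0)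
      (fun m => ?_) t π
    rw [h0]
    exact (mul_eq_zero.1 (congrFun h m)).resolve_left (sgn_ne_zero _)
  have hs (o g : Fin 7) (hog : o ≠ g) : s o g = 0 := by
    obtain ⟨π, rfl, rfl⟩ := exists_perm_apply_eq (show (0 : Fin 7) ≠ 3 by decide) hog
    have h1 : s (π 0) (π 3) + s (π 0) (π 4) = 0 := key 0 π
    have h2 : s (π 0) (π 3) + s (π 0) (π 5) = 0 := by
      have := key 0 (π * Equiv.swap 4 5)
      rwa [Equiv.Perm.coe_mul] at this
    have h3 : s (π 0) (π 5) + s (π 0) (π 4) = 0 := by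
      have := key 0 (π * Equiv.swap 3 5)
      rwa [Equiv.Perm.coe_mul] at this
    linarith
  refine ⟨hs, funext fun o => ?_⟩
  let π := Equiv.swap 0 o
  have h2 : s (π 0) (π 6) - r (π 0) = 0 := key 2 π
  rwa [hs _ _ (π.injective.ne (by decide)), zero_sub, neg_eq_zero, Equiv.swap_apply_left] at h2

theorem injective_coprod : Function.Injective (vectorR.coprod vectorS) := by
  rw [injective_iff_map_eq_zero]
  rintro ⟨r, f⟩ h
  rw [LinearMap.coprod_apply, vectorR_add_vectorS] at h
  obtain ⟨hs, hr⟩ := eq_zero_of_identityVector_eq_zero h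
  refine Prod.ext hr (funext fun p => ?_)
  exact (extendDiag_of_ne f p.2).symm.trans (hs _ _ p.2)

theorem injective_vectorR : Function.Injective vectorR := by
  rw [← LinearMap.coprod_inl vectorR vectorS]
  exact injective_coprod.comp LinearMap.inl_injective

theorem injective_vectorS : Function.Injective vectorS := by
  rw [← LinearMap.coprod_inr vectorR vectorS]
  exact injective_coprod.comp LinearMap.inr_injective

theorem range_eq_span_of_single {ι α V : Type*} [Fintype ι] [DecidableEq ι] [AddCommGroup V]
    [Module ℚ V] (L : (ι → ℚ) →ₗ[ℚ] V) (p : α → ι) (hp : Function.Surjective p) (c : α → ℚ)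
    (hc : ∀ a, c a * c a = 1) (u : α → V) (hu : ∀ a, u a = c a • L (Pi.single (p a) 1)) :
    LinearMap.range L = Submodule.span ℚ (Set.range u) := by
  refine le_antisymm ?_ (Submodule.span_le.2 ?_)
  · rw [LinearMap.range_eq_map, ← (Pi.basisFun ℚ ι).span_eq, Submodule.map_span_le]
    rintro _ ⟨i, rfl⟩
    obtain ⟨a, rfl⟩ := hp i
    rw [Pi.basisFun_apply, ← one_smul ℚ (L (Pi.single (p a) 1)), ← hc a, mul_smul, hc a, ← hu]
    exact Submodule.smul_mem _ _ (Submodule.subset_span ⟨a, rfl⟩)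
  · rintro _ ⟨a, rfl⟩
    rw [hu]
    exact Submodule.smul_mem _ _ ⟨_, rfl⟩

theorem range_vectorR : LinearMap.range vectorR = spanR :=
  range_eq_span_of_single vectorR (fun π : Equiv.Perm (Fin 7) => π 0)
    (fun o => ⟨Equiv.swap 0 o, Equiv.swap_apply_left ..⟩) sgn sgn_mul_self vecR vecR_eq

theorem range_vectorS : LinearMap.range vectorS = spanS := by
  refine range_eq_span_of_single vectorS
    (fun π : Equiv.Perm (Fin 7) => ⟨(π 0, π 6), π.injective.ne (by decide)⟩) ?_ sgn sgn_mul_self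
    vecS fun π => ?_
  · rintro ⟨⟨o, g⟩, h⟩
    obtain ⟨π, rfl, rfl⟩ := exists_perm_apply_eq (show (0 : Fin 7) ≠ 6 by decide) h
    exact ⟨π, rfl⟩
  · rw [vecS_eq]
    simp [vectorS, extendDiag_single]

theorem range_coprod_vectorR_vectorS :
    LinearMap.range (vectorR.coprod vectorS) = spanR ⊔ spanS := by
  rw [LinearMap.range_coprod, range_vectorR, range_vectorS]

theorem disjoint_spanR_spanS : spanR ⊓ spanS = ⊥ := by
  rw [eq_bot_iff, ← range_vectorR, ← range_vectorS]
  rintro _ ⟨⟨r, rfl⟩, f, hf⟩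
  have h : vectorR.coprod vectorS (r, 0) = vectorR.coprod vectorS (0, f) := by simp [hf]
  rw [(Prod.mk.inj (injective_coprod h)).1, map_zero]
  exact Submodule.zero_mem _

theorem card_offDiag : Fintype.card {p : Fin 7 × Fin 7 // p.1 ≠ p.2} = 42 := by
  decide

theorem sum_smul_evalMon7_eq_zero_iff (x : Mon7 → ℚ) :
    (∀ (D : Type) [AddCommGroup D] [Module ℚ D] (A : Dialgebra ℚ D) (v : Fin 7 → D),
        ∑ m : Mon7, x m • evalMon7 A v m = 0) ↔ x ∈ spanR ⊔ spanS := by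
  rw [← range_coprod_vectorR_vectorS]
  constructor
  · intro hx
    obtain ⟨s, r, rfl⟩ := exists_eq_identityVector x (wordCoef_eq_zero_of_forall x hx)
    exact ⟨(r, _), (identityVector_eq_vectorR_add_vectorS s r).symm⟩
  · rintro ⟨⟨r, f⟩, rfl⟩ D _ _ A v
    rw [LinearMap.coprod_apply, vectorR_add_vectorS]
    exact sum_smul_evalMon7_identityVector _ r A v

/-- a coefficient vector `x ∈ ℚ^{Mon7}` gives an identity of the PATS in
every associative dialgebra over `ℚ` iff it lies in `spanR ⊔ spanS`; this space of
identities has dimension 49 and is the direct sum of the `S₇`-submodule generated by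
`R` (dimension 7) and the `S₇`-submodule generated by `S` (dimension 42).  In
particular every multilinear identity of degree ≤ 7 of the PATS is a consequence of
`P ≡ 0`, `Q ≡ 0`, `R ≡ 0` and `S ≡ 0`. -/
theorem degree7_identities :
    (∀ x : Mon7 → ℚ,
      (∀ (D : Type) [AddCommGroup D] [Module ℚ D] (A : Dialgebra ℚ D) (v : Fin 7 → D),
          ∑ m : Mon7, x m • evalMon7 A v m = 0)
        ↔ x ∈ spanR ⊔ spanS) ∧
    spanR ⊓ spanS = ⊥ ∧
    Module.finrank ℚ ↥spanR = 7 ∧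
    Module.finrank ℚ ↥spanS = 42 ∧
    Module.finrank ℚ ↥(spanR ⊔ spanS) = 49 := by
  refine ⟨sum_smul_evalMon7_eq_zero_iff, disjoint_spanR_spanS, ?_, ?_, ?_⟩
  · rw [← range_vectorR, LinearMap.finrank_range_of_inj injective_vectorR,
      Module.finrank_fintype_fun_eq_card, Fintype.card_fin]
  · rw [← range_vectorS, LinearMap.finrank_range_of_inj injective_vectorS,
      Module.finrank_fintype_fun_eq_card, card_offDiag]
  · rw [← range_coprod_vectorR_vectorS, LinearMap.finrank_range_of_inj injective_coprod,
      Module.finrank_prod, Module.finrank_fintype_fun_eq_card,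
      Module.finrank_fintype_fun_eq_card, card_offDiag, Fintype.card_fin]
end

section
/- In every associative dialgebra D over a commutative ring, the PATS satisfies the nonlinear degree-7 identity 12·I_{211111} = 0 in variables a (occurring twice) and b,c,d,e,f: for all a,b,c,d,e,f ∈ D, 3Σ₁ − Σ₂ − Σ₃ − 2Σ₄ = 0, where σ ranges over all permutations of the five letters (a,c,d,e,f) and Σ₁ = Σ_{σ∈S₅} ε(σ)[[[b,aσ,cσ],a,dσ],eσ,fσ], Σ₂ = Σ_{σ∈S₅} ε(σ)[[b,[aσ,cσ,dσ],a],eσ,fσ], Σ₃ = Σ_{σ∈S₅} ε(σ)[[b,aσ,cσ],[dσ,eσ,fσ],a], Σ₄ = Σ_{σ∈S₅} ε(σ)[b,[[aσ,cσ,dσ],a,eσ],fσ]. The identities obtained by interchanging b with c, d, e or f also hold. -/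
/-- `12·I₂₁₁₁₁₁` with outer fixed letter `x` (the letter `b`), inner fixed letter `a`,
and `σ`-permuted letters `w 0,…,w 4` (the letters `a,c,d,e,f`):
`3Σε(σ)[[[x,w(σ0),w(σ1)],a,w(σ2)],w(σ3),w(σ4)] − Σε(σ)[[x,[w(σ0),w(σ1),w(σ2)],a],w(σ3),w(σ4)]
 − Σε(σ)[[x,w(σ0),w(σ1)],[w(σ2),w(σ3),w(σ4)],a] − 2Σε(σ)[x,[[w(σ0),w(σ1),w(σ2)],a,w(σ3)],w(σ4)]`. -/
def I211111 {k D : Type*} [CommRing k] [AddCommGroup D] [Module k D]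
    (A : Dialgebra k D) (x a : D) (w : Fin 5 → D) : D :=
  (3 : ℤ) • (∑ σ : Equiv.Perm (Fin 5), (Equiv.Perm.sign σ : ℤ) •
      A.pats (A.pats (A.pats x (w (σ 0)) (w (σ 1))) a (w (σ 2))) (w (σ 3)) (w (σ 4)))
  - (∑ σ : Equiv.Perm (Fin 5), (Equiv.Perm.sign σ : ℤ) •
      A.pats (A.pats x (A.pats (w (σ 0)) (w (σ 1)) (w (σ 2))) a) (w (σ 3)) (w (σ 4)))
  - (∑ σ : Equiv.Perm (Fin 5), (Equiv.Perm.sign σ : ℤ) •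
      A.pats (A.pats x (w (σ 0)) (w (σ 1))) (A.pats (w (σ 2)) (w (σ 3)) (w (σ 4))) a)
  - (2 : ℤ) • (∑ σ : Equiv.Perm (Fin 5), (Equiv.Perm.sign σ : ℤ) •
      A.pats x (A.pats (A.pats (w (σ 0)) (w (σ 1)) (w (σ 2))) a (w (σ 3))) (w (σ 4)))

namespace PatsIdentity

open TensorProduct

section Superalgebra

variable {k E : Type*} [CommRing k] [Ring E] [Algebra k E]

variable (k) in
/-- The exterior algebra on five generators. -/
abbrev Ext5 : Type _ := ExteriorAlgebra k (Fin 5 → k)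

variable (k E) in
/-- The algebra `E ⊗ Ext5 k`, as a type whose only algebraic structure is that of a ring. -/
def Super : Type _ := E ⊗[k] Ext5 k

noncomputable instance : Ring (Super k E) := inferInstanceAs (Ring (E ⊗[k] Ext5 k))

/-- The pure tensor of `x` and `u`. -/
def tm (x : E) (u : Ext5 k) : Super k E := x ⊗ₜ[k] u

lemma add_tm (x y : E) (u : Ext5 k) : tm (x + y) u = tm x u + tm y u := add_tmul x y u

lemma neg_tm (x : E) (u : Ext5 k) : tm (-x) u = -tm x u := neg_tmul x u

lemma sub_tm (x y : E) (u : Ext5 k) : tm (x - y) u = tm x u - tm y u := sub_tmul x y u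

lemma tm_zero (x : E) : tm x (0 : Ext5 k) = 0 := tmul_zero _ x

lemma tm_sub (x : E) (u v : Ext5 k) : tm x (u - v) = tm x u - tm x v := tmul_sub x u v

lemma tm_zsmul (x : E) (n : ℤ) (u : Ext5 k) : tm x (n • u) = n • tm x u :=
  (AddMonoidHom.mk' (tm x) (tmul_add x)).map_zsmul n u

lemma tm_mul_tm (x y : E) (u v : Ext5 k) : tm x u * tm y v = tm (x * y) (u * v) :=
  Algebra.TensorProduct.tmul_mul_tmul x y u v

lemma tm_one_one : tm (1 : E) (1 : Ext5 k) = 1 := rfl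

@[elab_as_elim]
lemma Super.induction {P : Super k E → Prop} (zero : P 0) (tm : ∀ x u, P (tm x u))
    (add : ∀ y z, P y → P z → P (y + z)) (y : Super k E) : P y :=
  TensorProduct.induction_on y zero tm add

/-- The `i`-th generator of `Ext5 k`. -/
noncomputable def gen (i : Fin 5) : Ext5 k := ExteriorAlgebra.ι k (Pi.single i 1)

/-- The element `∑ X i ⊗ e i` of `E ⊗ Ext5 k` attached to a family `X` in `E`. -/
noncomputable def hat {ι : Type*} [Fintype ι] (e : ι → Ext5 k) (X : ι → E) : Super k E :=
  ∑ i, tm (X i) (e i)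

/-- The alternating sum of the six products of `x`, `y`, `z`. -/
def tri {R : Type*} [Ring R] (x y z : R) : R :=
  x * y * z - x * z * y - y * x * z + y * z * x + z * x * y - z * y * x

/-- The operator `x ↦ [x, b, c]` in terms of the left and right multiplications
`l₁, r₁` by `b` and `l₂, r₂` by `c`. -/
def brk {R : Type*} [Ring R] (l₁ r₁ l₂ r₂ : R) : R :=
  l₁ * l₂ - l₂ * l₁ + r₂ * r₁ - r₁ * r₂ - l₁ * r₂ + l₂ * r₁

lemma gen_mul_gen (i j : Fin 5) : (gen j * gen i : Ext5 k) = (-1 : ℤ) • (gen i * gen j) := by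
  rw [neg_one_smul]
  exact eq_neg_of_add_eq_zero_left (ExteriorAlgebra.ι_add_mul_swap _ _)

section Families

variable {ι κ μ : Type*} [Fintype ι] [Fintype κ] [Fintype μ]

lemma hat_add (e : ι → Ext5 k) (X Y : ι → E) :
    hat e (fun i => X i + Y i) = hat e X + hat e Y := by
  simp [hat, add_tm, Finset.sum_add_distrib]

lemma hat_sub (e : ι → Ext5 k) (X Y : ι → E) :
    hat e (fun i => X i - Y i) = hat e X - hat e Y := by
  simp [hat, sub_tm, Finset.sum_sub_distrib]

lemma hat_neg (e : ι → Ext5 k) (X : ι → E) :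
    hat e (fun i => - X i) = - hat e X := by
  simp [hat, neg_tm]

lemma hat_mul (e : ι → Ext5 k) (e' : κ → Ext5 k) (X : ι → E) (Y : κ → E) :
    hat (fun p : ι × κ => e p.1 * e' p.2) (fun p => X p.1 * Y p.2) = hat e X * hat e' Y := by
  simp [hat, tm_mul_tm, Finset.sum_mul_sum, Fintype.sum_prod_type]

/-- Reindexing a family whose exterior factors change by a sign. -/
lemma hat_reindex {e : ι → Ext5 k} {e' : κ → Ext5 k} {s : ℤ} (σ : ι ≃ κ)
    (h : ∀ i, e' (σ i) = s • e i) (hs : s * s = 1) (X : κ → E) :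
    hat e (fun i => X (σ i)) = s • hat e' X := by
  simp only [hat, ← σ.sum_comp, h, tm_zsmul, ← Finset.smul_sum, smul_smul, hs, one_smul]

lemma hat_mul_swap {e : ι → Ext5 k} {e' : κ → Ext5 k} {s : ℤ}
    (h : ∀ i j, e' j * e i = s • (e i * e' j)) (hs : s * s = 1) (X : ι → E) (Y : κ → E) :
    hat (fun p : ι × κ => e p.1 * e' p.2) (fun p => Y p.2 * X p.1)
      = s • (hat e' Y * hat e X) := by
  rw [← hat_mul]
  exact hat_reindex (Equiv.prodComm ι κ) (fun p => h p.1 p.2) hs (fun p => Y p.1 * X p.2)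

lemma hat_brk {e : ι → Ext5 k} {e' : κ → Ext5 k} {s : ℤ}
    (h : ∀ i j, e' j * e i = s • (e i * e' j)) (hs : s * s = 1) (L R : ι → E) (L' R' : κ → E) :
    hat (fun p : ι × κ => e p.1 * e' p.2) (fun p => brk (L p.1) (R p.1) (L' p.2) (R' p.2))
      = hat e L * hat e' L' - s • (hat e' L' * hat e L) + s • (hat e' R' * hat e R)
        - hat e R * hat e' R' - hat e L * hat e' R' + s • (hat e' L' * hat e R) := by
  simp only [brk, hat_add, hat_sub, hat_mul, hat_mul_swap h hs]

lemma hat_tri {e : ι → Ext5 k} {e' : κ → Ext5 k} {e'' : μ → Ext5 k} {s t u : ℤ}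
    (hs : ∀ i j, e' j * e i = s • (e i * e' j)) (ht : ∀ i k, e'' k * e i = t • (e i * e'' k))
    (hu : ∀ j k, e'' k * e' j = u • (e' j * e'' k))
    (hs' : s * s = 1) (ht' : t * t = 1) (hu' : u * u = 1)
    (X : ι → E) (Y : κ → E) (Z : μ → E) :
    hat (fun p : (ι × κ) × μ => e p.1.1 * e' p.1.2 * e'' p.2)
        (fun p => tri (X p.1.1) (Y p.1.2) (Z p.2))
      = hat e X * hat e' Y * hat e'' Z - u • (hat e X * hat e'' Z * hat e' Y)
        - s • (hat e' Y * hat e X * hat e'' Z) + (s * t) • (hat e' Y * hat e'' Z * hat e X)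
        + (t * u) • (hat e'' Z * hat e X * hat e' Y)
        - (s * t * u) • (hat e'' Z * hat e' Y * hat e X) := by
  have h₁ (i : ι) (j : κ) (k : μ) : e i * e'' k * e' j = u • (e i * e' j * e'' k) := by
    rw [mul_assoc, hu, mul_smul_comm, mul_assoc]
  have h₂ (i : ι) (j : κ) (k : μ) : e' j * e i * e'' k = s • (e i * e' j * e'' k) := by
    rw [hs, smul_mul_assoc]
  have h₃ (i : ι) (j : κ) (k : μ) : e' j * e'' k * e i = (s * t) • (e i * e' j * e'' k) := by
    rw [mul_assoc, ht, mul_smul_comm, ← mul_assoc, h₂, smul_smul, mul_comm]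
  have h₄ (i : ι) (j : κ) (k : μ) : e'' k * e i * e' j = (t * u) • (e i * e' j * e'' k) := by
    rw [ht, smul_mul_assoc, h₁, smul_smul]
  have h₅ (i : ι) (j : κ) (k : μ) : e'' k * e' j * e i = (s * t * u) • (e i * e' j * e'' k) := by
    rw [hu, smul_mul_assoc, h₃, smul_smul, mul_comm u]
  have hst : s * t * (s * t) = 1 := by rw [mul_mul_mul_comm, hs', ht', one_mul]
  have htu : t * u * (t * u) = 1 := by rw [mul_mul_mul_comm, ht', hu', one_mul]
  have hstu : s * t * u * (s * t * u) = 1 := by rw [mul_mul_mul_comm, hst, hu', one_mul]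
  simp only [tri, hat_add, hat_sub]
  congr 1; congr 1; congr 1; congr 1; congr 1
  all_goals simp only [← hat_mul]
  · exact hat_reindex (e' := fun p : (ι × μ) × κ => e p.1.1 * e'' p.1.2 * e' p.2)
      ⟨fun p => ((p.1.1, p.2), p.1.2), fun p => ((p.1.1, p.2), p.1.2), fun _ => rfl, fun _ => rfl⟩
      (fun p => h₁ p.1.1 p.1.2 p.2) hu' (fun p => X p.1.1 * Z p.1.2 * Y p.2)
  · exact hat_reindex (e' := fun p : (κ × ι) × μ => e' p.1.1 * e p.1.2 * e'' p.2)
      ⟨fun p => ((p.1.2, p.1.1), p.2), fun p => ((p.1.2, p.1.1), p.2), fun _ => rfl, fun _ => rfl⟩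
      (fun p => h₂ p.1.1 p.1.2 p.2) hs' (fun p => Y p.1.1 * X p.1.2 * Z p.2)
  · exact hat_reindex (e' := fun p : (κ × μ) × ι => e' p.1.1 * e'' p.1.2 * e p.2)
      ⟨fun p => ((p.1.2, p.2), p.1.1), fun p => ((p.2, p.1.1), p.1.2), fun _ => rfl, fun _ => rfl⟩
      (fun p => h₃ p.1.1 p.1.2 p.2) hst (fun p => Y p.1.1 * Z p.1.2 * X p.2)
  · exact hat_reindex (e' := fun p : (μ × ι) × κ => e'' p.1.1 * e p.1.2 * e' p.2)
      ⟨fun p => ((p.2, p.1.1), p.1.2), fun p => ((p.1.2, p.2), p.1.1), fun _ => rfl, fun _ => rfl⟩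
      (fun p => h₄ p.1.1 p.1.2 p.2) htu (fun p => Z p.1.1 * X p.1.2 * Y p.2)
  · exact hat_reindex (e' := fun p : (μ × κ) × ι => e'' p.1.1 * e' p.1.2 * e p.2)
      ⟨fun p => ((p.2, p.1.2), p.1.1), fun p => ((p.2, p.1.2), p.1.1), fun _ => rfl, fun _ => rfl⟩
      (fun p => h₅ p.1.1 p.1.2 p.2) hstu (fun p => Z p.1.1 * Y p.1.2 * X p.2)

lemma hat_const_mul (e : ι → Ext5 k) (c : E) (X : ι → E) :
    hat e (fun i => c * X i) = tm c 1 * hat e X := by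
  simp [hat, tm_mul_tm, Finset.mul_sum]

lemma hat_mul_const (e : ι → Ext5 k) (X : ι → E) (c : E) :
    hat e (fun i => X i * c) = hat e X * tm c 1 := by
  simp [hat, tm_mul_tm, Finset.sum_mul]

lemma hat_tri_const {e : ι → Ext5 k} {e' : κ → Ext5 k} {s : ℤ}
    (h : ∀ i j, e' j * e i = s • (e i * e' j)) (hs : s * s = 1) (X : ι → E) (c : E) (Y : κ → E) :
    hat (fun p : ι × κ => e p.1 * e' p.2) (fun p => tri (X p.1) c (Y p.2))
      = hat e X * tm c 1 * hat e' Y - hat e X * hat e' Y * tm c 1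
        - tm c 1 * hat e X * hat e' Y + s • (tm c 1 * hat e' Y * hat e X)
        + s • (hat e' Y * hat e X * tm c 1) - s • (hat e' Y * tm c 1 * hat e X) := by
  have h₁ := hat_mul e e' (fun i => X i * c) Y
  have h₂ := hat_mul e e' (fun i => c * X i) Y
  have h₃ := hat_mul_swap h hs X (fun j => c * Y j)
  have h₄ := hat_mul_swap h hs X (fun j => Y j * c)
  simp only [hat_const_mul, hat_mul_const] at h₁ h₂ h₃ h₄
  simp only [tri, hat_add, hat_sub, hat_mul_const, hat_mul, hat_mul_swap h hs, smul_mul_assoc,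
    h₁, h₂, h₃, h₄]

end Families

/-- The coefficient of the product of the five generators in order. -/
noncomputable def topForm : Ext5 k →ₗ[k] k :=
  ExteriorAlgebra.liftAlternating (Pi.single 5 Matrix.detRowAlternating)

lemma topForm_ιMulti (v : Fin 5 → Fin 5 → k) :
    topForm (ExteriorAlgebra.ιMulti k 5 v) = Matrix.detRowAlternating v := by
  rw [topForm, ExteriorAlgebra.liftAlternating_apply_ιMulti, Pi.single_eq_same]

lemma prod_gen (f : Fin 5 → Fin 5) :
    (gen (f 0) * gen (f 1) * gen (f 2) * gen (f 3) * gen (f 4) : Ext5 k)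
      = ExteriorAlgebra.ιMulti k 5 (fun i => Pi.single (f i) (1 : k)) := by
  rw [ExteriorAlgebra.ιMulti_apply]
  simp only [List.ofFn_succ, List.ofFn_zero, List.prod_cons, List.prod_nil, mul_one, gen, mul_assoc]
  rfl

/-- The map `E ⊗ Ext5 k → E` taking the coefficient of the product of the five generators. -/
noncomputable def topCoeff : Super k E →+ E :=
  ((TensorProduct.rid k E).toLinearMap ∘ₗ LinearMap.lTensor E topForm).toAddMonoidHom

lemma topCoeff_tm (x : E) (y : Ext5 k) : topCoeff (tm x y) = topForm y • x :=
  TensorProduct.rid_tmul _ _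

lemma sum_topForm_smul (F : (Fin 5 → Fin 5) → E) :
    ∑ f : Fin 5 → Fin 5, Matrix.detRowAlternating (fun i => Pi.single (f i) (1 : k)) • F f
      = ∑ σ : Equiv.Perm (Fin 5), (Equiv.Perm.sign σ : ℤ) • F σ := by
  symm
  refine Finset.sum_of_injOn (fun σ => ⇑σ) DFunLike.coe_injective.injOn (by simp) ?_ ?_
  · intro f _ hf
    have h : ¬ Function.Injective f := fun h =>
      hf ⟨Equiv.ofBijective f (Finite.injective_iff_bijective.1 h), by simp, rfl⟩
    rw [AlternatingMap.map_eq_zero_of_not_injective, zero_smul]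
    exact fun h' => h fun i j hij => h' (by simp only [hij])
  · intro σ _
    have h := Matrix.detRowAlternating.map_perm (fun i : Fin 5 => Pi.single i (1 : k)) σ
    have h₁ : Matrix.detRowAlternating (fun i : Fin 5 => Pi.single i (1 : k)) = 1 := by
      rw [← Matrix.det_one (n := Fin 5) (R := k)]
      congr 1
      ext i j
      simp [Matrix.one_apply, Pi.single_apply, eq_comm]
    rw [h₁] at h
    simp only [Function.comp_def] at h
    rw [h, Units.smul_def, smul_assoc, one_smul]

lemma sum_fin_succ_fun {n : ℕ} {M : Type*} [AddCommMonoid M] (G : (Fin (n + 1) → Fin 5) → M) :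
    ∑ f, G f = ∑ i, ∑ g : Fin n → Fin 5, G (Fin.cons i g) := by
  rw [← (Fin.consEquiv fun _ => Fin 5).sum_comp, Fintype.sum_prod_type]
  rfl

lemma topCoeff_sum (F : Fin 5 → Fin 5 → Fin 5 → Fin 5 → Fin 5 → E) :
    topCoeff (∑ i, ∑ j, ∑ k', ∑ m, ∑ n,
        tm (F i j k' m n) (gen i * gen j * gen k' * gen m * gen n : Ext5 k))
      = ∑ σ : Equiv.Perm (Fin 5),
          (Equiv.Perm.sign σ : ℤ) • F (σ 0) (σ 1) (σ 2) (σ 3) (σ 4) := by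
  rw [← sum_topForm_smul (k := k) fun f => F (f 0) (f 1) (f 2) (f 3) (f 4)]
  simp only [← topForm_ιMulti, ← prod_gen, ← topCoeff_tm, ← map_sum]
  refine congrArg _ ?_
  simp only [sum_fin_succ_fun, Fintype.sum_unique]
  refine Finset.sum_congr rfl fun i _ => Finset.sum_congr rfl fun j _ => ?_
  refine Finset.sum_congr rfl fun k' _ => Finset.sum_congr rfl fun m _ => ?_
  refine Finset.sum_congr rfl fun n _ => ?_
  rfl

/-- Contraction with the coordinate form dual to the generator `gen 0`. -/
noncomputable def contract : Super k E →+ Super k E :=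
  (LinearMap.lTensor E (CliffordAlgebra.contractLeft (LinearMap.proj 0))).toAddMonoidHom

lemma contract_tm (x : E) (y : Ext5 k) :
    contract (tm x y) = tm x (CliffordAlgebra.contractLeft (LinearMap.proj 0) y) :=
  rfl

lemma contract_hat_mul (X : Fin 5 → E) (y : Super k E) :
    contract (hat gen X * y) = tm (X 0) 1 * y - hat gen X * contract y := by
  induction y using Super.induction with
  | zero => simp
  | add y z hy hz => rw [mul_add, map_add, hy, hz, map_add]; noncomm_ring
  | tm a u =>
    have h (i : Fin 5) : CliffordAlgebra.contractLeft (Q := (0 : QuadraticForm k (Fin 5 → k)))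
        (LinearMap.proj 0) (gen i * u)
          = (if i = 0 then u else 0) - gen i * CliffordAlgebra.contractLeft (LinearMap.proj 0) u := by
      rw [gen, CliffordAlgebra.contractLeft_ι_mul]
      by_cases hi : i = 0
      · simp [hi]
      · simp [hi]
    have h' (i : Fin 5) : tm (X i * a) (if i = 0 then u else 0)
        = if i = 0 then tm (X i * a) u else 0 := by
      split_ifs <;> simp only [tm_zero]
    simp only [hat, Finset.sum_mul, tm_mul_tm, map_sum, contract_tm, h, tm_sub, h',
      Finset.sum_sub_distrib, Finset.sum_ite_eq', Finset.mem_univ, if_true, one_mul]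

lemma contract_hat (X : Fin 5 → E) : contract (k := k) (hat gen X) = tm (X 0) 1 := by
  have h := contract_hat_mul (k := k) X 1
  rwa [← tm_one_one, contract_tm, CliffordAlgebra.contractLeft_one, tm_zero, mul_zero, sub_zero,
    tm_one_one, mul_one, mul_one] at h

lemma prod_six_gen (f : Fin 6 → Fin 5) :
    (gen (f 0) * (gen (f 1) * (gen (f 2) * (gen (f 3) * (gen (f 4) * gen (f 5))))) : Ext5 k)
      = 0 := by
  have h : ExteriorAlgebra.ιMulti k 6 (fun i => (Pi.single (f i) 1 : Fin 5 → k)) = 0 := by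
    refine AlternatingMap.map_eq_zero_of_not_injective _ _ fun h => ?_
    have := Fintype.card_le_of_injective f fun i j hij => h (by simp only [hij])
    simp at this
  rw [ExteriorAlgebra.ιMulti_apply] at h
  rw [← h]
  simp only [List.ofFn_succ, List.ofFn_zero, List.prod_cons, List.prod_nil, mul_one, gen]
  rfl

lemma hat_mul_six (X₀ X₁ X₂ X₃ X₄ X₅ : Fin 5 → E) :
    hat (k := k) gen X₀ * (hat gen X₁ * (hat gen X₂ * (hat gen X₃ * (hat gen X₄ *
      hat gen X₅)))) = 0 := by
  simp only [← hat_mul]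
  refine Finset.sum_eq_zero fun p _ => ?_
  have := prod_six_gen (k := k) ![p.1, p.2.1, p.2.2.1, p.2.2.2.1, p.2.2.2.2.1, p.2.2.2.2.2]
  exact (congrArg _ this).trans (tm_zero _)

lemma hat_gen_mul_swap {L R : Fin 5 → E} (h : ∀ i j, L i * R j = R j * L i) :
    hat (k := k) gen R * hat gen L = -(hat gen L * hat gen R) := by
  have h₁ := hat_mul_swap (k := k) gen_mul_gen (by norm_num) L R
  simp only [← h, hat_mul] at h₁
  rw [h₁, neg_one_smul, neg_neg]

lemma hat_brk_gen (L R : Fin 5 → E) :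
    hat (k := k) (fun p : Fin 5 × Fin 5 => gen p.1 * gen p.2)
        (fun p => brk (L p.1) (R p.1) (L p.2) (R p.2))
      = (2 : ℤ) • (hat gen L * hat gen L - hat gen R * hat gen R - hat gen L * hat gen R) := by
  rw [hat_brk gen_mul_gen (by norm_num)]
  module

lemma hat_tri_gen (X : Fin 5 → E) :
    hat (k := k) (fun p : (Fin 5 × Fin 5) × Fin 5 => gen p.1.1 * gen p.1.2 * gen p.2)
        (fun p => tri (X p.1.1) (X p.1.2) (X p.2))
      = (6 : ℤ) • (hat gen X * hat gen X * hat gen X) := by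
  rw [hat_tri gen_mul_gen gen_mul_gen gen_mul_gen (by norm_num) (by norm_num) (by norm_num)]
  module

lemma gen_mul_gen_three (p : (Fin 5 × Fin 5) × Fin 5) (i : Fin 5) :
    gen i * (gen p.1.1 * gen p.1.2 * gen p.2)
      = (-1 : ℤ) • (gen p.1.1 * gen p.1.2 * gen p.2 * gen i : Ext5 k) := by
  rw [mul_assoc _ (gen p.2), gen_mul_gen i p.2]
  simp only [neg_one_smul, mul_neg, neg_mul, ← mul_assoc, gen_mul_gen p.1.1 i]
  rw [mul_assoc (gen p.1.1) (gen i), gen_mul_gen p.1.2 i]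
  simp [mul_assoc]

lemma hat_tri_tri_gen (X : Fin 5 → E) (c : E) :
    hat (k := k)
        (fun p : ((Fin 5 × Fin 5) × Fin 5) × Fin 5 =>
          gen p.1.1.1 * gen p.1.1.2 * gen p.1.2 * gen p.2)
        (fun p => tri (tri (X p.1.1.1) (X p.1.1.2) (X p.1.2)) c (X p.2))
      = (6 : ℤ) • (hat gen X * hat gen X * hat gen X * tm c 1 * hat gen X
        + hat gen X * tm c 1 * hat gen X * hat gen X * hat gen X
        - (2 : ℤ) • (hat gen X * hat gen X * hat gen X * hat gen X * tm c 1)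
        - (2 : ℤ) • (tm c 1 * hat gen X * hat gen X * hat gen X * hat gen X)) := by
  have h := hat_tri_const (k := k) gen_mul_gen_three (by norm_num)
    (fun p => tri (X p.1.1) (X p.1.2) (X p.2)) c X
  rw [h, hat_tri_gen]
  simp only [mul_smul_comm, smul_mul_assoc, ← mul_assoc]
  module

lemma gen_mul_gen_four (p : ((Fin 5 × Fin 5) × Fin 5) × Fin 5) (i : Fin 5) :
    gen i * (gen p.1.1.1 * gen p.1.1.2 * gen p.1.2 * gen p.2)
      = (1 : ℤ) • (gen p.1.1.1 * gen p.1.1.2 * gen p.1.2 * gen p.2 * gen i : Ext5 k) := by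
  rw [← mul_assoc, gen_mul_gen_three, smul_mul_assoc, mul_assoc _ (gen i), gen_mul_gen p.2 i,
    mul_smul_comm, smul_smul, ← mul_assoc]
  norm_num

end Superalgebra

/-- For `l`, `r` odd and `a`, `b` even, the identity below holds in the superalgebra generated
by them, `δ` being the odd derivation with `δ l = a` and `δ r = b`. -/
lemma derivation_identity {S : Type*} [Ring S] (l r a b : S) (δ : S →+ S)
    (hrl : r * l = -(l * r)) (hra : r * a = a * r) (hbl : b * l = l * b)
    (hl : ∀ y, δ (l * y) = a * y - l * δ y) (hr : ∀ y, δ (r * y) = b * y - r * δ y)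
    (hδl : δ l = a) (hδr : δ r = b) (p c q t u : S)
    (hp : p = (2 : ℤ) • (l * l - r * r - l * r))
    (hc : c = brk a b l r)
    (hq : q = (6 : ℤ) • (l * l * l * a - a * l * l * l - b * r * r * r + r * r * r * b
      - l * l * l * b - a * r * r * r))
    (ht : t = (6 : ℤ) • (l * l * l * a * l + l * a * l * l * l - (2 : ℤ) • (l * l * l * l * a)
      - (2 : ℤ) • (a * l * l * l * l)))
    (hu : u = (6 : ℤ) • (r * r * r * b * r + r * b * r * r * r - (2 : ℤ) • (r * r * r * r * b)
      - (2 : ℤ) • (b * r * r * r * r))) :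
    (3 : ℤ) • (p * c * p) - p * q - q * p - (2 : ℤ) • brk t u l r
      = (36 : ℤ) • δ (l * (l * (l * (l * (l * l)))) - l * (l * (l * (l * (l * r))))
        - l * (l * (l * (l * (r * r)))) + l * (l * (l * (r * (r * r))))
        + l * (l * (r * (r * (r * r)))) - l * (r * (r * (r * (r * r))))
        - r * (r * (r * (r * (r * r))))) := by
  have hrl' (x : S) : r * (l * x) = -(l * (r * x)) := by rw [← mul_assoc, hrl, neg_mul, mul_assoc]
  have hra' (x : S) : r * (a * x) = a * (r * x) := by rw [← mul_assoc, hra, mul_assoc]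
  have hbl' (x : S) : b * (l * x) = l * (b * x) := by rw [← mul_assoc, hbl, mul_assoc]
  subst hp hc hq ht hu
  simp only [map_add, map_sub, hl, hr, hδl, hδr]
  simp only [brk, mul_add, add_mul, mul_sub, sub_mul, smul_mul_assoc, mul_smul_comm, mul_assoc,
    hrl, hrl', hra, hra', hbl, hbl', mul_neg, neg_mul, neg_neg]
  module

section Operators

variable {k E : Type*} [CommRing k] [Ring E] [Algebra k E]

lemma topCoeff_hat_mul_mul (X : Fin 5 × Fin 5 → E) (Y : Fin 5 → E) (Z : Fin 5 × Fin 5 → E) :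
    topCoeff (hat (k := k) (fun p : Fin 5 × Fin 5 => gen p.1 * gen p.2) X * hat gen Y *
        hat (fun p : Fin 5 × Fin 5 => gen p.1 * gen p.2) Z)
      = ∑ σ : Equiv.Perm (Fin 5), (Equiv.Perm.sign σ : ℤ) •
        (X (σ 0, σ 1) * Y (σ 2) * Z (σ 3, σ 4)) := by
  rw [← hat_mul, ← hat_mul, ← topCoeff_sum (k := k) fun i j m n o => X (i, j) * Y m * Z (n, o)]
  simp only [hat, Fintype.sum_prod_type, mul_assoc]

lemma topCoeff_hat_two_three (X : Fin 5 × Fin 5 → E) (Y : (Fin 5 × Fin 5) × Fin 5 → E) :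
    topCoeff (hat (k := k) (fun p : Fin 5 × Fin 5 => gen p.1 * gen p.2) X *
        hat (fun p : (Fin 5 × Fin 5) × Fin 5 => gen p.1.1 * gen p.1.2 * gen p.2) Y)
      = ∑ σ : Equiv.Perm (Fin 5), (Equiv.Perm.sign σ : ℤ) •
        (X (σ 0, σ 1) * Y ((σ 2, σ 3), σ 4)) := by
  rw [← hat_mul, ← topCoeff_sum (k := k) fun i j m n o => X (i, j) * Y ((m, n), o)]
  simp only [hat, Fintype.sum_prod_type, mul_assoc]

lemma topCoeff_hat_three_two (X : (Fin 5 × Fin 5) × Fin 5 → E) (Y : Fin 5 × Fin 5 → E) :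
    topCoeff (hat (k := k)
        (fun p : (Fin 5 × Fin 5) × Fin 5 => gen p.1.1 * gen p.1.2 * gen p.2) X *
          hat (fun p : Fin 5 × Fin 5 => gen p.1 * gen p.2) Y)
      = ∑ σ : Equiv.Perm (Fin 5), (Equiv.Perm.sign σ : ℤ) •
        (X ((σ 0, σ 1), σ 2) * Y (σ 3, σ 4)) := by
  rw [← hat_mul, ← topCoeff_sum (k := k) fun i j m n o => X ((i, j), m) * Y (n, o)]
  simp only [hat, Fintype.sum_prod_type, mul_assoc]

lemma topCoeff_hat_five (X : (((Fin 5 × Fin 5) × Fin 5) × Fin 5) × Fin 5 → E) :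
    topCoeff (hat (k := k) (fun p : (((Fin 5 × Fin 5) × Fin 5) × Fin 5) × Fin 5 =>
        gen p.1.1.1.1 * gen p.1.1.1.2 * gen p.1.1.2 * gen p.1.2 * gen p.2) X)
      = ∑ σ : Equiv.Perm (Fin 5), (Equiv.Perm.sign σ : ℤ) •
        X ((((σ 0, σ 1), σ 2), σ 3), σ 4) := by
  rw [← topCoeff_sum (k := k) fun i j m n o => X ((((i, j), m), n), o)]
  simp only [hat, Fintype.sum_prod_type]

lemma brk_eq_zsmul {S : Type*} [Ring S] (l₁ r₁ l₂ r₂ : S) :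
    brk l₁ r₁ l₂ r₂ = l₁ * l₂ - (1 : ℤ) • (l₂ * l₁) + (1 : ℤ) • (r₂ * r₁) - r₁ * r₂ - l₁ * r₂
      + (1 : ℤ) • (l₂ * r₁) := by
  simp only [one_zsmul, brk]

lemma hat_brk_four_gen (X Y : ((Fin 5 × Fin 5) × Fin 5) × Fin 5 → E) (L R : Fin 5 → E) :
    hat (k := k) (fun p : (((Fin 5 × Fin 5) × Fin 5) × Fin 5) × Fin 5 =>
        gen p.1.1.1.1 * gen p.1.1.1.2 * gen p.1.1.2 * gen p.1.2 * gen p.2)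
        (fun p => brk (X p.1) (Y p.1) (L p.2) (R p.2))
      = brk
        (hat (fun p => gen p.1.1.1 * gen p.1.1.2 * gen p.1.2 * gen p.2) X)
        (hat (fun p => gen p.1.1.1 * gen p.1.1.2 * gen p.1.2 * gen p.2) Y)
        (hat gen L) (hat gen R) := by
  exact (hat_brk gen_mul_gen_four (one_mul 1) X Y L R).trans (brk_eq_zsmul _ _ _ _).symm

/-- The operator identity behind `I211111`, with the permuted letters numbered in the order of
their occurrence. -/
lemma alternating_identity (k : Type*) {E : Type*} [CommRing k] [Ring E] [Algebra k E]
    {L R : Fin 5 → E} (h : ∀ i j, L i * R j = R j * L i) :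
    (3 : ℤ) • (∑ σ : Equiv.Perm (Fin 5), (Equiv.Perm.sign σ : ℤ) •
        (brk (L (σ 0)) (R (σ 0)) (L (σ 1)) (R (σ 1)) * brk (L 0) (R 0) (L (σ 2)) (R (σ 2))
          * brk (L (σ 3)) (R (σ 3)) (L (σ 4)) (R (σ 4))))
    - (∑ σ : Equiv.Perm (Fin 5), (Equiv.Perm.sign σ : ℤ) •
        (brk (L (σ 0)) (R (σ 0)) (L (σ 1)) (R (σ 1))
          * brk (tri (L (σ 2)) (L (σ 3)) (L (σ 4))) (-tri (R (σ 2)) (R (σ 3)) (R (σ 4)))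
              (L 0) (R 0)))
    - (∑ σ : Equiv.Perm (Fin 5), (Equiv.Perm.sign σ : ℤ) •
        (brk (tri (L (σ 0)) (L (σ 1)) (L (σ 2))) (-tri (R (σ 0)) (R (σ 1)) (R (σ 2))) (L 0) (R 0)
          * brk (L (σ 3)) (R (σ 3)) (L (σ 4)) (R (σ 4))))
    - (2 : ℤ) • (∑ σ : Equiv.Perm (Fin 5), (Equiv.Perm.sign σ : ℤ) •
        brk (tri (tri (L (σ 0)) (L (σ 1)) (L (σ 2))) (L 0) (L (σ 3)))
          (tri (tri (R (σ 0)) (R (σ 1)) (R (σ 2))) (R 0) (R (σ 3))) (L (σ 4)) (R (σ 4))) = 0 := by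
  have hra : hat (k := k) gen R * tm (L 0) 1 = tm (L 0) 1 * hat gen R := by
    rw [← hat_mul_const, ← hat_const_mul]
    simp only [h]
  have hbl : tm (R 0) (1 : Ext5 k) * hat gen L = hat gen L * tm (R 0) 1 := by
    rw [← hat_mul_const, ← hat_const_mul]
    simp only [h]
  have hc : hat (k := k) gen (fun i => brk (L 0) (R 0) (L i) (R i))
      = brk (tm (L 0) 1) (tm (R 0) 1) (hat gen L) (hat gen R) := by
    simp only [brk, hat_add, hat_sub, hat_const_mul, hat_mul_const]
  have hq : hat (k := k) (fun p : (Fin 5 × Fin 5) × Fin 5 => gen p.1.1 * gen p.1.2 * gen p.2)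
      (fun p => brk (tri (L p.1.1) (L p.1.2) (L p.2)) (-tri (R p.1.1) (R p.1.2) (R p.2))
        (L 0) (R 0))
      = (6 : ℤ) • (hat gen L * hat gen L * hat gen L * tm (L 0) 1
        - tm (L 0) 1 * hat gen L * hat gen L * hat gen L
        - tm (R 0) 1 * hat gen R * hat gen R * hat gen R
        + hat gen R * hat gen R * hat gen R * tm (R 0) 1
        - hat gen L * hat gen L * hat gen L * tm (R 0) 1
        - tm (L 0) 1 * hat gen R * hat gen R * hat gen R) := by
    simp only [brk, hat_add, hat_sub, hat_const_mul, hat_mul_const, hat_neg, hat_tri_gen,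
      mul_neg, neg_mul, mul_smul_comm, smul_mul_assoc, ← mul_assoc]
    module
  have hv := hat_brk_four_gen (k := k)
    (fun p => tri (tri (L p.1.1.1) (L p.1.1.2) (L p.1.2)) (L 0) (L p.2))
    (fun p => tri (tri (R p.1.1.1) (R p.1.1.2) (R p.1.2)) (R 0) (R p.2)) L R
  have key := derivation_identity (hat (k := k) gen L) (hat gen R) (tm (L 0) 1) (tm (R 0) 1)
    contract (hat_gen_mul_swap h) hra hbl (contract_hat_mul L) (contract_hat_mul R)
    (contract_hat L) (contract_hat R) _ _ _ _ _ (hat_brk_gen L R) hc hq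
    (hat_tri_tri_gen L (L 0)) (hat_tri_tri_gen R (R 0))
  simp only [hat_mul_six, add_zero, sub_zero, map_zero, smul_zero] at key
  rw [← hv] at key
  have h₀ := congrArg topCoeff key
  simp only [map_sub, map_zsmul, topCoeff_hat_mul_mul, topCoeff_hat_two_three,
    topCoeff_hat_three_two, topCoeff_hat_five, map_zero] at h₀
  exact h₀

end Operators

/-- An even permutation of the letters does not change an alternating sum. -/
lemma sum_sign_smul_comp {M : Type*} [AddCommGroup M] (τ : Equiv.Perm (Fin 5))
    (hτ : Equiv.Perm.sign τ = 1) (F : Fin 5 → Fin 5 → Fin 5 → Fin 5 → Fin 5 → M)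
    {i₀ i₁ i₂ i₃ i₄ : Fin 5} (h₀ : τ 0 = i₀) (h₁ : τ 1 = i₁) (h₂ : τ 2 = i₂) (h₃ : τ 3 = i₃)
    (h₄ : τ 4 = i₄) :
    ∑ σ : Equiv.Perm (Fin 5), (Equiv.Perm.sign σ : ℤ) • F (σ i₀) (σ i₁) (σ i₂) (σ i₃) (σ i₄)
      = ∑ σ : Equiv.Perm (Fin 5),
          (Equiv.Perm.sign σ : ℤ) • F (σ 0) (σ 1) (σ 2) (σ 3) (σ 4) := by
  subst h₀ h₁ h₂ h₃ h₄
  rw [← Equiv.sum_comp (Equiv.mulRight τ)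
    fun σ => (Equiv.Perm.sign σ : ℤ) • F (σ 0) (σ 1) (σ 2) (σ 3) (σ 4)]
  simp [hτ]

lemma tri_neg_left {S : Type*} [Ring S] (x y z : S) : tri (-x) y z = -tri x y z := by
  simp only [tri, neg_mul, mul_neg]
  abel

section Dialgebra

variable {k D : Type*} [CommRing k] [AddCommGroup D] [Module k D] (A : Dialgebra k D)

lemma pats_eq_brk (x b c : D) :
    A.pats x b c = brk (R := Module.End k D) (A.r b) (A.l.flip b) (A.r c) (A.l.flip c) x := by
  simp only [Dialgebra.pats, brk, A.inner_assoc, LinearMap.add_apply, LinearMap.sub_apply,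
    Module.End.mul_apply, LinearMap.flip_apply]
  abel

lemma r_pats (x y z : D) :
    A.r (A.pats x y z) = tri (R := Module.End k D) (A.r x) (A.r y) (A.r z) := by
  ext w
  simp only [Dialgebra.pats, tri, A.bar_right, A.r_assoc, A.inner_assoc, map_add, map_sub,
    LinearMap.add_apply, LinearMap.sub_apply, Module.End.mul_apply]
  abel

lemma flip_l_pats (x y z : D) :
    A.l.flip (A.pats x y z)
      = -tri (R := Module.End k D) (A.l.flip x) (A.l.flip y) (A.l.flip z) := by
  ext w
  simp only [Dialgebra.pats, tri, ← A.bar_left, ← A.l_assoc, map_add, map_sub,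
    LinearMap.add_apply, LinearMap.sub_apply, LinearMap.neg_apply, Module.End.mul_apply,
    LinearMap.flip_apply]
  abel

lemma flip_l_pats_pats (x y z b c : D) :
    A.l.flip (A.pats (A.pats x y z) b c)
      = tri (R := Module.End k D) (tri (R := Module.End k D) (A.l.flip x) (A.l.flip y)
          (A.l.flip z)) (A.l.flip b) (A.l.flip c) := by
  rw [flip_l_pats, flip_l_pats, tri_neg_left, neg_neg]

lemma r_mul_flip_l (b c : D) :
    (A.r b * A.l.flip c : Module.End k D) = A.l.flip c * A.r b := by
  ext x
  simp only [Module.End.mul_apply, LinearMap.flip_apply, A.inner_assoc]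

theorem I211111_eq_zero (x : D) (w : Fin 5 → D) : I211111 A x (w 0) w = 0 := by
  -- abstracting `L` and `R` keeps the kernel from unfolding the products in `Module.End k D`
  obtain ⟨L, hL⟩ : ∃ L : Fin 5 → Module.End k D, ∀ i, L i = A.r (w i) := ⟨_, fun _ => rfl⟩
  obtain ⟨R, hR⟩ : ∃ R : Fin 5 → Module.End k D, ∀ i, R i = A.l.flip (w i) := ⟨_, fun _ => rfl⟩
  have h (i j : Fin 5) : L i * R j = R j * L i := by rw [hL, hR, r_mul_flip_l]
  have key := LinearMap.congr_fun (alternating_identity k h) x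
  have hτ : Equiv.Perm.sign (Equiv.swap 0 3 * Equiv.swap 1 4 : Equiv.Perm (Fin 5)) = 1 := by
    rw [map_mul, Equiv.Perm.sign_swap (by decide), Equiv.Perm.sign_swap (by decide), neg_mul_neg,
      one_mul]
  have hρ (n : ℕ) : Equiv.Perm.sign (finRotate 5 ^ n) = 1 := by
    rw [map_pow, sign_finRotate, Even.neg_one_pow ⟨2, rfl⟩, one_pow]
  have h₁ := sum_sign_smul_comp (i₀ := 3) (i₁ := 4) (i₂ := 2) (i₃ := 0) (i₄ := 1) _ hτ
    (fun i₀ i₁ i₂ i₃ i₄ => A.pats (A.pats (A.pats x (w i₃) (w i₄)) (w 0) (w i₂)) (w i₀) (w i₁))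
    (by decide) (by decide) (by decide) (by decide) (by decide)
  have h₂ := sum_sign_smul_comp (i₀ := 3) (i₁ := 4) (i₂ := 0) (i₃ := 1) (i₄ := 2) _ (hρ 3)
    (fun i₀ i₁ i₂ i₃ i₄ => A.pats (A.pats x (A.pats (w i₂) (w i₃) (w i₄)) (w 0)) (w i₀) (w i₁))
    (by decide) (by decide) (by decide) (by decide) (by decide)
  have h₃ := sum_sign_smul_comp (i₀ := 2) (i₁ := 3) (i₂ := 4) (i₃ := 0) (i₄ := 1) _ (hρ 2)
    (fun i₀ i₁ i₂ i₃ i₄ => A.pats (A.pats x (w i₃) (w i₄)) (A.pats (w i₀) (w i₁) (w i₂)) (w 0))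
    (by decide) (by decide) (by decide) (by decide) (by decide)
  rw [I211111, h₁, h₂, h₃]
  simpa only [LinearMap.sub_apply, LinearMap.smul_apply, LinearMap.sum_apply,
    Module.End.mul_apply, LinearMap.zero_apply, hL, hR, ← flip_l_pats, ← flip_l_pats_pats,
    ← r_pats, ← pats_eq_brk] using key

end Dialgebra

end PatsIdentity

/-- the PATS satisfies the nonlinear degree-7 identity `12·I₂₁₁₁₁₁ = 0`
in the variables `a,a,b,c,d,e,f` (σ permuting the five letters `(a,c,d,e,f)`, with `b`
the outer fixed letter), together with the four identities obtained by interchanging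
`b` with `c`, `d`, `e`, `f`. -/
theorem pats_identity_I211111
    (k D : Type*) [CommRing k] [AddCommGroup D] [Module k D]
    (A : Dialgebra k D) (a b c d e f : D) :
    I211111 A b a ![a,c,d,e,f] = 0 ∧
    I211111 A c a ![a,b,d,e,f] = 0 ∧
    I211111 A d a ![a,c,b,e,f] = 0 ∧
    I211111 A e a ![a,c,d,b,f] = 0 ∧
    I211111 A f a ![a,c,d,e,b] = 0 := by
  exact ⟨PatsIdentity.I211111_eq_zero A b ![a,c,d,e,f],
    PatsIdentity.I211111_eq_zero A c ![a,b,d,e,f],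
    PatsIdentity.I211111_eq_zero A d ![a,c,b,e,f],
    PatsIdentity.I211111_eq_zero A e ![a,c,d,b,f],
    PatsIdentity.I211111_eq_zero A f ![a,c,d,e,b]⟩
end

section
/- In every associative dialgebra D over a commutative ring, for all a,b,c,d,e ∈ D the nested PATS expands as [[a,b,c],d,e] = âbcde − âbced − âcbde + âcbed − bâcde + bâced + câbde − câbed − dâbce + dâcbe + eâbcd − eâcbd + bcâde − bcâed − cbâde + cbâed + dbâce − dcâbe + deâbc − deâcb − ebâcd + ecâbd − edâbc + edâcb − dbcâe + dcbâe − debâc + decâb + ebcâd − ecbâd + edbâc − edcâb + debcâ − decbâ − edbcâ + edcbâ. -/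
section Hats
variable {k D : Type*} [CommRing k] [AddCommGroup D] [Module k D]

/-- Normal form `x̂₁x₂x₃x₄x₅ = x₁ ⊣ x₂ ⊣ x₃ ⊣ x₄ ⊣ x₅` (center in position 1). -/
def Dialgebra.hat1 (A : Dialgebra k D) (x₁ x₂ x₃ x₄ x₅ : D) : D :=
  A.l (A.l (A.l (A.l x₁ x₂) x₃) x₄) x₅

/-- Normal form `x₁x̂₂x₃x₄x₅ = x₁ ⊢ x₂ ⊣ (x₃ ⊣ x₄ ⊣ x₅)` (center in position 2). -/
def Dialgebra.hat2 (A : Dialgebra k D) (x₁ x₂ x₃ x₄ x₅ : D) : D :=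
  A.r x₁ (A.l (A.l (A.l x₂ x₃) x₄) x₅)

/-- Normal form `x₁x₂x̂₃x₄x₅ = (x₁ ⊢ x₂) ⊢ x₃ ⊣ (x₄ ⊣ x₅)` (center in position 3). -/
def Dialgebra.hat3 (A : Dialgebra k D) (x₁ x₂ x₃ x₄ x₅ : D) : D :=
  A.r (A.r x₁ x₂) (A.l (A.l x₃ x₄) x₅)

/-- Normal form `x₁x₂x₃x̂₄x₅ = (x₁ ⊢ x₂ ⊢ x₃) ⊢ x₄ ⊣ x₅` (center in position 4). -/
def Dialgebra.hat4 (A : Dialgebra k D) (x₁ x₂ x₃ x₄ x₅ : D) : D :=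
  A.r (A.r (A.r x₁ x₂) x₃) (A.l x₄ x₅)

/-- Normal form `x₁x₂x₃x₄x̂₅ = x₁ ⊢ x₂ ⊢ x₃ ⊢ x₄ ⊢ x₅` (center in position 5). -/
def Dialgebra.hat5 (A : Dialgebra k D) (x₁ x₂ x₃ x₄ x₅ : D) : D :=
  A.r (A.r (A.r (A.r x₁ x₂) x₃) x₄) x₅

end Hats

/-- expansion of the nested PATS `[[a,b,c],d,e]` into 36 dialgebra
monomials in normal (hat) form. -/
theorem expansion_abc_d_e
    (k D : Type*) [CommRing k] [AddCommGroup D] [Module k D]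
    (A : Dialgebra k D) (a b c d e : D) :
    A.pats (A.pats a b c) d e =
        A.hat1 a b c d e - A.hat1 a b c e d - A.hat1 a c b d e + A.hat1 a c b e d
      - A.hat2 b a c d e + A.hat2 b a c e d + A.hat2 c a b d e - A.hat2 c a b e d
      - A.hat2 d a b c e + A.hat2 d a c b e + A.hat2 e a b c d - A.hat2 e a c b d
      + A.hat3 b c a d e - A.hat3 b c a e d - A.hat3 c b a d e + A.hat3 c b a e d
      + A.hat3 d b a c e - A.hat3 d c a b e + A.hat3 d e a b c - A.hat3 d e a c b
      - A.hat3 e b a c d + A.hat3 e c a b d - A.hat3 e d a b c + A.hat3 e d a c b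
      - A.hat4 d b c a e + A.hat4 d c b a e - A.hat4 d e b a c + A.hat4 d e c a b
      + A.hat4 e b c a d - A.hat4 e c b a d + A.hat4 e d b a c - A.hat4 e d c a b
      + A.hat5 d e b c a - A.hat5 d e c b a - A.hat5 e d b c a + A.hat5 e d c b a := by
  simp only [Dialgebra.pats, Dialgebra.hat1, Dialgebra.hat2, Dialgebra.hat3, Dialgebra.hat4,
    Dialgebra.hat5, map_add, map_sub, LinearMap.add_apply, LinearMap.sub_apply, A.l_assoc,
    A.r_assoc, A.inner_assoc]
  abel
end
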